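/- arXiv:1811.04398 — 2 statements merged into one kernel-verified Lean document; each statement's English description precedes it below -/
import Mathlib

section
/- Let K be a simplicial complex on [m], k a field, and α a partition of [m] into r blocks that is nondegenerate for K. For every q ≥ 0, Σ_{L⊆[r]} dim_k H̃^{|L|−q−1}(K|_{ω_L}; k) ≥ C(r − dim(K) − 1, q), where ω_L = ⋃_{i∈L} α_i, K|_ω is the full subcomplex on ω, H̃ denotes reduced simplicial cohomology (with H̃^{−1}(∅) = k), and C(n,q) is the binomial coefficient (taken as 0 if q > n). -/
open Finset

/-- An abstract simplicial complex on the vertex set `Fin m`. -/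
structure SimplicialComplexOn (m : ℕ) where
  faces : Set (Finset (Fin m))
  down_closed : ∀ σ ∈ faces, ∀ τ ⊆ σ, τ ∈ faces
  empty_mem : (∅ : Finset (Fin m)) ∈ faces
  singleton_mem : ∀ j : Fin m, {j} ∈ faces

/-- `dim K + 1`, i.e. the maximal cardinality of a face of `K`. -/
noncomputable def SimplicialComplexOn.dimAdd1 {m : ℕ} (K : SimplicialComplexOn m) : ℕ :=
  sSup {n : ℕ | ∃ σ ∈ K.faces, σ.card = n}

/-- A partition of `[m]`, encoded as a coloring `c : Fin m → Fin r`
(the block `α_i` being the fiber `c ⁻¹ {i}`), is nondegenerate for `K` if every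
face of `K` meets each block in at most one vertex; equivalently, the two
vertices of any 1-simplex of `K` lie in different blocks. -/
def IsNondegenerate {m r : ℕ} (K : SimplicialComplexOn m) (c : Fin m → Fin r) : Prop :=
  ∀ σ ∈ K.faces, ∀ j ∈ σ, ∀ j' ∈ σ, c j = c j' → j = j'

/-- For a coloring `c : Fin m → Fin r` encoding the partition `α` and a set of
colors `L ⊆ [r]`, `omegaOf c L = ω_L = ⋃_{i ∈ L} α_i ⊆ [m]`. -/
def omegaOf {m r : ℕ} (c : Fin m → Fin r) (L : Finset (Fin r)) : Finset (Fin m) :=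
  Finset.univ.filter (fun j => c j ∈ L)

open Classical in
/-- The reduced simplicial cochain group in degree `j ∈ ℤ` of the full
subcomplex `K|_ω` with coefficients in `k`: functions on the faces of `K`
contained in `ω` having `j + 1` vertices.  (In degree `j = -1` this is spanned
by the empty face, giving the convention `H̃^{-1}(∅; k) = k`; in degrees
`j < -1` it is the zero module.) -/
abbrev redCochain {m : ℕ} (K : SimplicialComplexOn m) (ω : Finset (Fin m))
    (k : Type*) [Field k] (j : ℤ) : Type _ :=
  {σ : Finset (Fin m) // σ ∈ K.faces ∧ σ ⊆ ω ∧ (σ.card : ℤ) = j + 1} → k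

open Classical in
/-- The simplicial coboundary map `redCochain a → redCochain b` (which is the
usual coboundary `δ` when `b = a + 1`, and zero otherwise):
`(δ f)(σ) = Σ_{x ∈ σ} (−1)^{|{y ∈ σ : y < x}|} f(σ \ x)`. -/
noncomputable def redCoboundary {m : ℕ} (K : SimplicialComplexOn m)
    (ω : Finset (Fin m)) (k : Type*) [Field k] (a b : ℤ) :
    redCochain K ω k a →ₗ[k] redCochain K ω k b where
  toFun f := fun σ => ∑ x ∈ σ.1.attach,
    if h : σ.1.erase x.1 ∈ K.faces ∧ σ.1.erase x.1 ⊆ ω ∧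
        (((σ.1.erase x.1).card : ℤ) = a + 1) then
      ((-1 : k) ^ (σ.1.filter (fun y => y < x.1)).card) * f ⟨σ.1.erase x.1, h⟩
    else 0
  map_add' f g := by
    funext σ
    simp only [Pi.add_apply]
    rw [← Finset.sum_add_distrib]
    refine Finset.sum_congr rfl fun x _ => ?_
    split
    · simp [mul_add]
    · simp
  map_smul' a f := by
    funext σ
    simp only [Pi.smul_apply, RingHom.id_apply, smul_eq_mul, Finset.mul_sum]
    refine Finset.sum_congr rfl fun x _ => ?_
    split
    · simp [mul_left_comm]
    · simp

/-- The reduced simplicial cohomology `H̃^j(K|_ω; k)` of the full subcomplex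
`K|_ω`, as the cohomology of the reduced cochain complex at degree `j`. -/
noncomputable def redCohomology {m : ℕ} (K : SimplicialComplexOn m)
    (ω : Finset (Fin m)) (k : Type*) [Field k] (j : ℤ) : Type _ :=
  ↥(LinearMap.ker (redCoboundary K ω k j (j + 1))) ⧸
    Submodule.comap (LinearMap.ker (redCoboundary K ω k j (j + 1))).subtype
      (Submodule.map (redCoboundary K ω k (j - 1) j) ⊤)

noncomputable instance {m : ℕ} (K : SimplicialComplexOn m) (ω : Finset (Fin m))
    (k : Type*) [Field k] (j : ℤ) : AddCommGroup (redCohomology K ω k j) :=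
  Submodule.Quotient.addCommGroup _

noncomputable instance {m : ℕ} (K : SimplicialComplexOn m) (ω : Finset (Fin m))
    (k : Type*) [Field k] (j : ℤ) : Module k (redCohomology K ω k j) :=
  Submodule.Quotient.module _

/-- The reduced Betti number `dim_k H̃^j(K|_ω; k)`. -/
noncomputable def redBetti {m : ℕ} (K : SimplicialComplexOn m) (ω : Finset (Fin m))
    (k : Type*) [Field k] (j : ℤ) : ℕ :=
  Module.finrank k (redCohomology K ω k j)

namespace ColoredBound

section Restrict

variable {α : Type*} (k : Type*) [Field k]

open Classical in
/-- Restriction of a function to a family of sets, extended by zero. -/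
noncomputable def restrict (P : Set (Finset α)) : (Finset α → k) →ₗ[k] (Finset α → k) where
  toFun f τ := if τ ∈ P then f τ else 0
  map_add' f g := by
    funext τ
    by_cases h : τ ∈ P <;> simp [h]
  map_smul' a f := by
    funext τ
    by_cases h : τ ∈ P <;> simp [h]

/-- The cochains on the family `P` concentrated on sets of cardinality `n`. -/
def cochains (P : Set (Finset α)) (n : ℤ) : Submodule k (Finset α → k) where
  carrier := {f | ∀ τ, f τ ≠ 0 → τ ∈ P ∧ (τ.card : ℤ) = n}
  add_mem' {f g} hf hg τ h := by
    by_cases h0 : f τ = 0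
    · exact hg τ fun h1 => h (by simp [h0, h1])
    · exact hf τ h0
  zero_mem' τ h := absurd rfl h
  smul_mem' a f hf τ h := hf τ fun h0 => h (by simp [h0])

variable {k}

theorem restrict_of_mem {P : Set (Finset α)} {τ : Finset α} (h : τ ∈ P) (f : Finset α → k) :
    restrict k P f τ = f τ := if_pos h

theorem restrict_of_notMem {P : Set (Finset α)} {τ : Finset α} (h : τ ∉ P)
    (f : Finset α → k) : restrict k P f τ = 0 := if_neg h

theorem restrict_mem_cochains {P Q : Set (Finset α)} {n : ℤ} {f : Finset α → k}
    (hf : f ∈ cochains k Q n) : restrict k P f ∈ cochains k P n := by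
  intro τ h
  by_cases hP : τ ∈ P
  · rw [restrict_of_mem hP] at h
    exact ⟨hP, (hf τ h).2⟩
  · exact absurd (restrict_of_notMem hP f) h

end Restrict

section Cochains

variable {α : Type*} [LinearOrder α] (k : Type*) [Field k]

/-- The simplicial coboundary on all functions on finite subsets of `α`. -/
def coboundary : (Finset α → k) →ₗ[k] (Finset α → k) where
  toFun f τ := ∑ x ∈ τ, (-1 : k) ^ (τ.filter (fun y => y < x)).card * f (τ.erase x)
  map_add' f g := by
    funext τ
    simp [mul_add, Finset.sum_add_distrib]
  map_smul' a f := by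
    funext τ
    simp [Finset.mul_sum, mul_left_comm]

variable {k}

theorem coboundary_apply (f : Finset α → k) (τ : Finset α) :
    coboundary k f τ =
      ∑ x ∈ τ, (-1 : k) ^ (τ.filter (fun y => y < x)).card * f (τ.erase x) := rfl

theorem exists_of_coboundary_ne_zero {f : Finset α → k} {τ : Finset α}
    (h : coboundary k f τ ≠ 0) : ∃ x ∈ τ, f (τ.erase x) ≠ 0 := by
  obtain ⟨x, hx, hne⟩ := Finset.exists_ne_zero_of_sum_ne_zero h
  exact ⟨x, hx, right_ne_zero_of_mul hne⟩

theorem coboundary_congr {f g : Finset α → k} {τ : Finset α}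
    (h : ∀ x ∈ τ, f (τ.erase x) = g (τ.erase x)) :
    coboundary k f τ = coboundary k g τ :=
  Finset.sum_congr rfl fun x hx => by rw [h x hx]

theorem sign_add_sign_eq_zero {τ : Finset α} {x y : α} (hx : x ∈ τ) (hxy : x < y) :
    (-1 : k) ^ (τ.filter (fun z => z < x)).card *
        (-1) ^ ((τ.erase x).filter (fun z => z < y)).card +
      (-1) ^ (τ.filter (fun z => z < y)).card *
        (-1) ^ ((τ.erase y).filter (fun z => z < x)).card = 0 := by
  have h₁ : (τ.erase y).filter (fun z => z < x) = τ.filter (fun z => z < x) := by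
    ext z
    simp only [mem_filter, mem_erase]
    exact ⟨fun h => ⟨h.1.2, h.2⟩, fun h => ⟨⟨(h.2.trans hxy).ne, h.1⟩, h.2⟩⟩
  have h₂ : (τ.filter (fun z => z < y)).card =
      ((τ.erase x).filter (fun z => z < y)).card + 1 := by
    rw [Finset.filter_erase, Finset.card_erase_add_one (by simp [hx, hxy])]
  rw [h₁, h₂, pow_succ]
  ring

theorem coboundary_coboundary (f : Finset α → k) : coboundary k (coboundary k f) = 0 := by
  funext τ
  simp only [coboundary_apply, Finset.mul_sum, Pi.zero_apply]
  rw [Finset.sum_sigma']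
  refine Finset.sum_involution (fun p _ => ⟨p.2, p.1⟩) ?_ ?_ ?_ ?_
  · rintro ⟨x, y⟩ h
    simp only [mem_sigma, mem_erase] at h
    obtain ⟨hx, hyx, hy⟩ := h
    simp only
    rw [Finset.erase_right_comm (a := y), ← mul_assoc, ← mul_assoc, ← add_mul]
    rcases lt_or_gt_of_ne hyx with hlt | hlt
    · rw [add_comm, sign_add_sign_eq_zero hy hlt, zero_mul]
    · rw [sign_add_sign_eq_zero hx hlt, zero_mul]
  · rintro ⟨x, y⟩ h _ heq
    simp only [mem_sigma, mem_erase] at h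
    simp only [Sigma.mk.injEq] at heq
    exact h.2.1 heq.1
  · rintro ⟨x, y⟩ h
    simp only [mem_sigma, mem_erase] at h ⊢
    exact ⟨h.2.2, h.2.1.symm, h.1⟩
  · rintro ⟨x, y⟩ _
    rfl

variable (k)

/-- The cocycles of the family `P` concentrated on sets of cardinality `n`. -/
def cocycles (P : Set (Finset α)) (n : ℤ) : Submodule k (Finset α → k) where
  carrier := {f | f ∈ cochains k P n ∧ ∀ τ ∈ P, coboundary k f τ = 0}
  add_mem' {f g} hf hg :=
    ⟨add_mem hf.1 hg.1, fun τ h => by simp [hf.2 τ h, hg.2 τ h]⟩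
  zero_mem' := ⟨zero_mem _, fun τ _ => by simp⟩
  smul_mem' a f hf := ⟨Submodule.smul_mem _ a hf.1, fun τ h => by simp [hf.2 τ h]⟩

/-- The coboundaries of the family `P` concentrated on sets of cardinality `n`. -/
noncomputable def coboundaries (P : Set (Finset α)) (n : ℤ) : Submodule k (Finset α → k) :=
  (cochains k P (n - 1)).map (restrict k P ∘ₗ coboundary k)

/-- The dimension of the cohomology of the family `P` at sets of cardinality `n`. -/
noncomputable def betti (P : Set (Finset α)) (n : ℤ) : ℕ :=
  Module.finrank k (cocycles k P n) - Module.finrank k (coboundaries k P n)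

variable {k}

theorem restrict_coboundary_mem_cochains {P Q : Set (Finset α)} {n : ℤ} {f : Finset α → k}
    (hf : f ∈ cochains k Q (n - 1)) : restrict k P (coboundary k f) ∈ cochains k P n := by
  intro τ h
  by_cases hP : τ ∈ P
  · rw [restrict_of_mem hP] at h
    obtain ⟨x, hx, hne⟩ := exists_of_coboundary_ne_zero h
    have h1 := (hf _ hne).2
    have h2 := Finset.card_erase_add_one hx
    exact ⟨hP, by omega⟩
  · exact absurd (restrict_of_notMem hP _) h

theorem coboundaries_le_cocycles {P : Set (Finset α)} (hP : P.OrdConnected) (n : ℤ) :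
    coboundaries k P n ≤ cocycles k P n := by
  rintro _ ⟨g, hg, rfl⟩
  refine ⟨restrict_coboundary_mem_cochains hg, fun τ hτ => ?_⟩
  refine Eq.trans ?_ (congrFun (coboundary_coboundary g) τ)
  refine coboundary_congr fun x hx => ?_
  by_cases hx' : τ.erase x ∈ P
  · exact restrict_of_mem hx' _
  · refine (restrict_of_notMem hx' _).trans ?_
    by_contra hne
    obtain ⟨y, -, hy⟩ := exists_of_coboundary_ne_zero (Ne.symm hne)
    exact hx' (hP.out (hg _ hy).1 hτ ⟨Finset.erase_subset _ _, Finset.erase_subset _ _⟩)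

end Cochains

theorem finrank_map_add_finrank_le {k V W : Type*} [Field k] [AddCommGroup V] [Module k V]
    [FiniteDimensional k V] [AddCommGroup W] [Module k W] (T : V →ₗ[k] W)
    {Z B : Submodule k V} (hB : B ≤ Z) (hT : B.map T = ⊥) :
    Module.finrank k (Z.map T) + Module.finrank k B ≤ Module.finrank k Z := by
  have h := LinearMap.finrank_range_add_finrank_ker (T.domRestrict Z)
  rw [LinearMap.range_domRestrict] at h
  have h1 : B.comap Z.subtype ≤ LinearMap.ker (T.domRestrict Z) := by
    intro z hz
    have : T z ∈ B.map T := Submodule.mem_map_of_mem hz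
    rw [hT] at this
    exact this
  have h2 := Submodule.finrank_mono h1
  rw [(Submodule.comapSubtypeEquivOfLe hB).finrank_eq] at h2
  omega

theorem finrank_eq_finrank_map_mkQ_add {k V : Type*} [Field k] [AddCommGroup V] [Module k V]
    [FiniteDimensional k V] (Z B : Submodule k V) :
    Module.finrank k Z =
      Module.finrank k (Z.map B.mkQ) + Module.finrank k (Z ⊓ B : Submodule k V) := by
  have h := LinearMap.finrank_range_add_finrank_ker (B.mkQ.domRestrict Z)
  rw [LinearMap.range_domRestrict, LinearMap.ker_domRestrict, Submodule.ker_mkQ] at h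
  rw [← h, ← Submodule.finrank_map_subtype_eq Z (B.comap Z.subtype),
    Submodule.map_comap_subtype]

section Exactness

variable {α : Type*} [LinearOrder α] [Fintype α] {k : Type*} [Field k]

/-- The dimension count in the long exact sequence of a family `B`, a lower subfamily `D`, and an
upper subfamily `A` that is a union of components of `B \ D`. -/
theorem betti_le_betti_add_betti {A B D : Set (Finset α)} (hB : B.OrdConnected)
    (hAB : A ⊆ B) (hDB : D ⊆ B) (hAD : ∀ τ ∈ A, τ ∉ D)
    (hD : ∀ τ ∈ B, ∀ ρ ∈ D, τ ⊆ ρ → τ ∈ D) (hA : ∀ τ ∈ A, ∀ ρ ∈ B, τ ⊆ ρ → ρ ∈ A)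
    (hsplit : ∀ τ ∈ B, ∀ ρ ∈ A, τ ⊆ ρ → τ ∈ A ∨ τ ∈ D) (n : ℤ) :
    betti k A n ≤ betti k D (n - 1) + betti k B n := by
  have hDc : D.OrdConnected :=
    ⟨fun τ hτ ρ hρ x hx => hD x (hB.out (hDB hτ) (hDB hρ) hx) ρ hρ hx.2⟩
  set T : (Finset α → k) →ₗ[k] (Finset α → k) := restrict k A ∘ₗ coboundary k with hTdef
  have hZ : cocycles k A n ≤ cocycles k B n := by
    intro f hf
    refine ⟨fun τ h => ⟨hAB (hf.1 τ h).1, (hf.1 τ h).2⟩, fun τ hτ => ?_⟩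
    by_contra hne
    obtain ⟨x, -, hx⟩ := exists_of_coboundary_ne_zero hne
    exact hne (hf.2 τ (hA _ (hf.1 _ hx).1 τ hτ (Finset.erase_subset _ _)))
  have hTB : (coboundaries k D (n - 1)).map T ≤ coboundaries k A n := by
    rintro _ ⟨_, ⟨g, hg, rfl⟩, rfl⟩
    rw [← neg_mem_iff]
    refine ⟨restrict k A (coboundary k g), restrict_coboundary_mem_cochains hg, ?_⟩
    simp only [hTdef, LinearMap.comp_apply]
    rw [eq_neg_iff_add_eq_zero, ← map_add, ← map_add]
    funext ρ
    by_cases hρ : ρ ∈ A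
    · rw [restrict_of_mem hρ, Pi.zero_apply, ← Pi.zero_apply (M := fun _ => k) ρ,
        ← coboundary_coboundary g]
      refine coboundary_congr fun x hx => ?_
      rw [Pi.add_apply]
      by_cases h1 : ρ.erase x ∈ A
      · rw [restrict_of_mem h1, restrict_of_notMem (hAD _ h1), add_zero]
      · by_cases h2 : ρ.erase x ∈ D
        · rw [restrict_of_notMem h1, restrict_of_mem h2, zero_add]
        · rw [restrict_of_notMem h1, restrict_of_notMem h2, zero_add]
          by_contra hne
          obtain ⟨y, -, hy⟩ := exists_of_coboundary_ne_zero (Ne.symm hne)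
          have h3 : ρ.erase x ∈ B := hB.out (hDB (hg _ hy).1) (hAB hρ)
            ⟨Finset.erase_subset _ _, Finset.erase_subset _ _⟩
          exact (hsplit _ h3 ρ hρ (Finset.erase_subset _ _)).elim h1 h2
    · exact restrict_of_notMem hρ _
  have hker : cocycles k A n ⊓ coboundaries k B n ≤
      coboundaries k A n ⊔ (cocycles k D (n - 1)).map T := by
    rintro _ ⟨hf, g, hg, rfl⟩
    have hgD : restrict k D g ∈ cocycles k D (n - 1) := by
      refine ⟨restrict_mem_cochains hg, fun ρ hρ => ?_⟩
      have h0 : restrict k B (coboundary k g) ρ = 0 := by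
        by_contra hne
        exact hAD ρ (hf.1 ρ hne).1 hρ
      rw [restrict_of_mem (hDB hρ)] at h0
      rw [← h0]
      refine coboundary_congr fun x _ => ?_
      by_cases h1 : ρ.erase x ∈ D
      · exact restrict_of_mem h1 _
      · rw [restrict_of_notMem h1]
        by_contra hne
        exact h1 (hD _ (hg _ (Ne.symm hne)).1 ρ hρ (Finset.erase_subset _ _))
    refine Submodule.mem_sup.2 ⟨T (restrict k A g), ⟨_, restrict_mem_cochains hg, rfl⟩,
      T (restrict k D g), ⟨_, hgD, rfl⟩, ?_⟩
    rw [← map_add]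
    funext ρ
    by_cases hρ : ρ ∈ A
    · simp only [hTdef, LinearMap.comp_apply]
      rw [restrict_of_mem hρ, restrict_of_mem (hAB hρ)]
      refine coboundary_congr fun x _ => ?_
      rw [Pi.add_apply]
      by_cases h1 : ρ.erase x ∈ A
      · rw [restrict_of_mem h1, restrict_of_notMem (hAD _ h1), add_zero]
      · by_cases h2 : ρ.erase x ∈ D
        · rw [restrict_of_notMem h1, restrict_of_mem h2, zero_add]
        · rw [restrict_of_notMem h1, restrict_of_notMem h2, zero_add]
          by_contra hne
          exact (hsplit _ (hg _ (Ne.symm hne)).1 ρ hρ (Finset.erase_subset _ _)).elim h1 h2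
    · refine (restrict_of_notMem hρ _).trans ?_
      by_contra hne
      exact hρ (hf.1 ρ (Ne.symm hne)).1
  have e1 := finrank_eq_finrank_map_mkQ_add (cocycles k A n) (coboundaries k B n)
  have e2 := finrank_map_add_finrank_le (coboundaries k B n).mkQ
    (coboundaries_le_cocycles hB n) (Submodule.mkQ_map_self _)
  have e3 := Submodule.finrank_mono (Submodule.map_mono (f := (coboundaries k B n).mkQ) hZ)
  have e4 := Submodule.finrank_mono hker
  have e5 := finrank_eq_finrank_map_mkQ_add
    (coboundaries k A n ⊔ (cocycles k D (n - 1)).map T) (coboundaries k A n)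
  rw [Submodule.map_sup, Submodule.mkQ_map_self, bot_sup_eq,
    inf_eq_right.2 le_sup_left, ← Submodule.map_comp] at e5
  have e6 := finrank_map_add_finrank_le ((coboundaries k A n).mkQ ∘ₗ T)
    (coboundaries_le_cocycles (k := k) hDc (n - 1)) (by
      rw [Submodule.map_comp, eq_bot_iff, ← Submodule.mkQ_map_self (coboundaries k A n)]
      exact Submodule.map_mono hTB)
  unfold betti
  omega

theorem one_le_betti_singleton (σ : Finset α) : 1 ≤ betti k {σ} σ.card := by
  have hB : coboundaries k {σ} (σ.card : ℤ) = ⊥ := by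
    rw [eq_bot_iff]
    rintro _ ⟨g, hg, rfl⟩
    have : g = 0 := by
      funext τ
      by_contra hne
      obtain ⟨rfl, h⟩ := hg τ hne
      omega
    simp [this]
  have hmem : Pi.single σ (1 : k) ∈ cocycles k {σ} (σ.card : ℤ) := by
    refine ⟨fun τ h => ?_, ?_⟩
    · by_cases hτ : τ = σ
      · exact ⟨hτ, by rw [hτ]⟩
      · exact absurd (Pi.single_eq_of_ne hτ _) h
    · rintro _ rfl
      refine Finset.sum_eq_zero fun x hx => ?_
      rw [Pi.single_eq_of_ne (Finset.erase_ne_self.2 hx), mul_zero]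
  unfold betti
  rw [hB, finrank_bot, Nat.sub_zero, Submodule.one_le_finrank_iff]
  intro h
  rw [h, Submodule.mem_bot, Pi.single_eq_zero_iff] at hmem
  exact one_ne_zero hmem

end Exactness

variable {m r : ℕ}

/-- The faces of `K` that contain `σ` and only have vertices with colors in `M`. -/
def starIn (K : SimplicialComplexOn m) (c : Fin m → Fin r) (σ : Finset (Fin m))
    (M : Finset (Fin r)) : Set (Finset (Fin m)) :=
  {τ | τ ∈ K.faces ∧ σ ⊆ τ ∧ τ ⊆ omegaOf c M}

theorem subset_omegaOf {c : Fin m → Fin r} {τ : Finset (Fin m)} {M : Finset (Fin r)} :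
    τ ⊆ omegaOf c M ↔ ∀ x ∈ τ, c x ∈ M := by
  simp [omegaOf, Finset.subset_iff]

theorem betti_starIn_insert_le (k : Type*) [Field k] {K : SimplicialComplexOn m}
    {c : Fin m → Fin r} (hnd : IsNondegenerate K c) (σ : Finset (Fin m)) {v : Fin m}
    {M : Finset (Fin r)} (n : ℤ) :
    betti k (starIn K c (insert v σ) M) n ≤
      betti k (starIn K c σ (M.erase (c v))) (n - 1) + betti k (starIn K c σ M) n := by
  apply betti_le_betti_add_betti
  · exact ⟨fun τ hτ ρ hρ x hx =>
      ⟨K.down_closed ρ hρ.1 x hx.2, hτ.2.1.trans hx.1, hx.2.trans hρ.2.2⟩⟩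
  · exact fun τ hτ => ⟨hτ.1, (Finset.subset_insert v σ).trans hτ.2.1, hτ.2.2⟩
  · exact fun τ hτ => ⟨hτ.1, hτ.2.1, subset_omegaOf.2 fun x hx =>
      Finset.mem_of_mem_erase (subset_omegaOf.1 hτ.2.2 x hx)⟩
  · exact fun τ hτ hτ' => Finset.notMem_erase (c v) M
      (subset_omegaOf.1 hτ'.2.2 v (hτ.2.1 (Finset.mem_insert_self v σ)))
  · exact fun τ hτ ρ hρ h => ⟨hτ.1, hτ.2.1, h.trans hρ.2.2⟩
  · exact fun τ hτ ρ hρ h => ⟨hρ.1, hτ.2.1.trans h, hρ.2.2⟩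
  · intro τ hτ ρ hρ h
    by_cases hv : v ∈ τ
    · exact Or.inl ⟨hτ.1, Finset.insert_subset hv hτ.2.1, hτ.2.2⟩
    · refine Or.inr ⟨hτ.1, hτ.2.1, subset_omegaOf.2 fun x hx => Finset.mem_erase.2
        ⟨fun hcx => hv ?_, subset_omegaOf.1 hτ.2.2 x hx⟩⟩
      rwa [← hnd ρ hρ.1 x (h hx) v (hρ.2.1 (Finset.mem_insert_self v σ)) hcx]

theorem sum_betti_starIn_insert_le (k : Type*) [Field k] {K : SimplicialComplexOn m}
    {c : Fin m → Fin r} (hnd : IsNondegenerate K c) {σ : Finset (Fin m)} {v : Fin m}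
    (hv : v ∉ σ) (hσ : insert v σ ∈ K.faces) (q : ℕ) :
    ∑ M with (insert v σ).image c ⊆ M, betti k (starIn K c (insert v σ) M) (M.card - q : ℤ) ≤
      ∑ M with σ.image c ⊆ M, betti k (starIn K c σ M) (M.card - q : ℤ) := by
  have hcv : c v ∉ σ.image c := by
    intro h
    obtain ⟨x, hx, hxv⟩ := Finset.mem_image.1 h
    have := hnd _ hσ x (Finset.mem_insert_of_mem hx) v (Finset.mem_insert_self v σ) hxv
    exact hv (this ▸ hx)
  refine (Finset.sum_le_sum fun M _ =>
    betti_starIn_insert_le k hnd σ (M := M) (M.card - q : ℤ)).trans ?_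
  rw [Finset.sum_add_distrib,
    ← Finset.sum_filter_add_sum_filter_not (univ.filter fun M => σ.image c ⊆ M)
      (fun M => c v ∉ M)]
  refine Nat.add_le_add (le_of_eq ?_) (le_of_eq ?_)
  · refine Finset.sum_bij' (fun M _ => M.erase (c v)) (fun M _ => insert (c v) M) ?_ ?_ ?_ ?_ ?_
    · intro M hM
      simp only [mem_filter, mem_univ, true_and, image_insert, insert_subset_iff] at hM ⊢
      exact ⟨Finset.subset_erase.2 ⟨hM.2, hcv⟩, Finset.notMem_erase _ _⟩
    · intro M hM
      simp only [mem_filter, mem_univ, true_and, image_insert] at hM ⊢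
      exact Finset.insert_subset_insert _ hM.1
    · intro M hM
      simp only [mem_filter, mem_univ, true_and, image_insert, insert_subset_iff] at hM
      exact Finset.insert_erase hM.1
    · intro M hM
      simp only [mem_filter, mem_univ, true_and] at hM
      exact Finset.erase_insert hM.2
    · intro M hM
      simp only [mem_filter, mem_univ, true_and, image_insert, insert_subset_iff] at hM
      have := Finset.card_erase_add_one hM.1
      congr 1
      omega
  · refine Finset.sum_congr ?_ fun _ _ => rfl
    ext M
    simp [image_insert, insert_subset_iff, and_comm]

theorem sum_betti_starIn_le (k : Type*) [Field k] {K : SimplicialComplexOn m}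
    {c : Fin m → Fin r} (hnd : IsNondegenerate K c) (q : ℕ) (σ : Finset (Fin m))
    (hσ : σ ∈ K.faces) :
    ∑ M with σ.image c ⊆ M, betti k (starIn K c σ M) (M.card - q : ℤ) ≤
      ∑ M, betti k (starIn K c ∅ M) (M.card - q : ℤ) := by
  induction σ using Finset.induction_on with
  | empty => simp
  | insert v σ hv ih =>
    exact (sum_betti_starIn_insert_le k hnd hv hσ q).trans
      (ih (K.down_closed _ hσ _ (Finset.subset_insert v σ)))

theorem choose_le_sum_betti_starIn (k : Type*) [Field k] {K : SimplicialComplexOn m}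
    {c : Fin m → Fin r} (hnd : IsNondegenerate K c) (q : ℕ) {σ : Finset (Fin m)}
    (hσ : σ ∈ K.faces) (hmax : ∀ τ ∈ K.faces, σ ⊆ τ → τ = σ) :
    (r - σ.card).choose q ≤
      ∑ M with σ.image c ⊆ M, betti k (starIn K c σ M) (M.card - q : ℤ) := by
  have hcard : (σ.image c).card = σ.card :=
    Finset.card_image_of_injOn fun x hx y hy h => hnd σ hσ x hx y hy h
  have hcount : (r - σ.card).choose q =
      ((powersetCard q (σ.image c)ᶜ).image (fun L => L ∪ σ.image c)).card := by
    rw [Finset.card_image_of_injOn, card_powersetCard, card_compl, hcard, Fintype.card_fin]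
    intro L hL L' hL' h
    simp only [mem_coe, mem_powersetCard, subset_compl_iff_disjoint_right] at hL hL'
    simp only at h
    rw [← Finset.union_sdiff_cancel_right hL.1, h, Finset.union_sdiff_cancel_right hL'.1]
  rw [hcount, Finset.card_eq_sum_ones]
  refine (Finset.sum_le_sum fun M hM => ?_).trans
    (Finset.sum_le_sum_of_subset (s := (powersetCard q (σ.image c)ᶜ).image
      (fun L => L ∪ σ.image c)) fun M hM => ?_)
  · obtain ⟨L, hL, rfl⟩ := Finset.mem_image.1 hM
    rw [mem_powersetCard, subset_compl_iff_disjoint_right] at hL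
    have hstar : starIn K c σ (L ∪ σ.image c) = {σ} := by
      ext τ
      refine ⟨fun h => hmax τ h.1 h.2.1, ?_⟩
      rintro rfl
      exact ⟨hσ, subset_rfl, subset_omegaOf.2 fun x hx =>
        Finset.mem_union_right _ (Finset.mem_image_of_mem c hx)⟩
    have hc : (((L ∪ σ.image c).card : ℤ) - q) = σ.card := by
      rw [Finset.card_union_of_disjoint hL.1, hcard, hL.2]
      push_cast
      ring
    rw [hstar, hc]
    exact one_le_betti_singleton σ
  · obtain ⟨L, -, rfl⟩ := Finset.mem_image.1 hM
    simp

section Comparison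

variable (K : SimplicialComplexOn m) (k : Type*) [Field k]

open Classical in
/-- Extension by zero of a reduced cochain. -/
noncomputable def extendCochain (ω : Finset (Fin m)) (j : ℤ) :
    redCochain K ω k j →ₗ[k] (Finset (Fin m) → k) where
  toFun f τ := if h : τ ∈ K.faces ∧ τ ⊆ ω ∧ (τ.card : ℤ) = j + 1 then f ⟨τ, h⟩ else 0
  map_add' f g := by
    funext τ
    simp only [Pi.add_apply]
    split <;> simp
  map_smul' a f := by
    funext τ
    simp only [Pi.smul_apply, RingHom.id_apply]
    split <;> simp

variable {K k} {ω : Finset (Fin m)}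

theorem extendCochain_coe {j : ℤ} (f : redCochain K ω k j)
    (σ : {σ : Finset (Fin m) // σ ∈ K.faces ∧ σ ⊆ ω ∧ (σ.card : ℤ) = j + 1}) :
    extendCochain K k ω j f σ.1 = f σ := dif_pos σ.2

theorem extendCochain_of_not {j : ℤ} (f : redCochain K ω k j) {τ : Finset (Fin m)}
    (h : ¬ (τ ∈ K.faces ∧ τ ⊆ ω ∧ (τ.card : ℤ) = j + 1)) :
    extendCochain K k ω j f τ = 0 := dif_neg h

theorem extendCochain_injective (j : ℤ) : Function.Injective (extendCochain K k ω j) := by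
  intro f g h
  funext σ
  rw [← extendCochain_coe f, h, extendCochain_coe]

theorem redCoboundary_apply_eq {a b : ℤ} (f : redCochain K ω k a)
    (σ : {σ : Finset (Fin m) // σ ∈ K.faces ∧ σ ⊆ ω ∧ (σ.card : ℤ) = b + 1}) :
    redCoboundary K ω k a b f σ = coboundary k (extendCochain K k ω a f) σ.1 := by
  rw [coboundary_apply, ← Finset.sum_attach]
  refine Finset.sum_congr rfl fun x _ => ?_
  simp only [extendCochain, LinearMap.coe_mk, AddHom.coe_mk, mul_dite, mul_zero]

theorem betti_le_redBetti (c : Fin m → Fin r) (M : Finset (Fin r)) (j : ℤ) :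
    betti k (starIn K c ∅ M) (j + 1) ≤ redBetti K (omegaOf c M) k j := by
  set ω := omegaOf c M with hω
  set P := starIn K c ∅ M with hP
  have hmem : ∀ τ, τ ∈ P ↔ τ ∈ K.faces ∧ τ ⊆ ω := fun τ => by simp [hP, starIn, hω]
  have hZ : cocycles k P (j + 1) ≤
      (LinearMap.ker (redCoboundary K ω k j (j + 1))).map (extendCochain K k ω j) := by
    intro f hf
    have hfe : extendCochain K k ω j (fun σ => f σ.1) = f := by
      funext τ
      by_cases h : τ ∈ K.faces ∧ τ ⊆ ω ∧ (τ.card : ℤ) = j + 1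
      · exact extendCochain_coe _ ⟨τ, h⟩
      · rw [extendCochain_of_not _ h]
        by_contra hne
        obtain ⟨h1, h2⟩ := hf.1 τ (Ne.symm hne)
        exact h ⟨((hmem τ).1 h1).1, ((hmem τ).1 h1).2, h2⟩
    refine ⟨fun σ => f σ.1, ?_, hfe⟩
    rw [SetLike.mem_coe, LinearMap.mem_ker]
    funext σ
    rw [redCoboundary_apply_eq, hfe]
    exact hf.2 σ.1 ((hmem _).2 ⟨σ.2.1, σ.2.2.1⟩)
  have hB : (Submodule.map (redCoboundary K ω k (j - 1) j) ⊤).map (extendCochain K k ω j) ≤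
      coboundaries k P (j + 1) := by
    rintro _ ⟨_, ⟨g, -, rfl⟩, rfl⟩
    have hg : extendCochain K k ω (j - 1) g ∈ cochains k P (j + 1 - 1) := by
      intro τ h
      by_contra hτ
      exact h (extendCochain_of_not g fun h' =>
        hτ ⟨(hmem τ).2 ⟨h'.1, h'.2.1⟩, by rw [h'.2.2]; ring⟩)
    refine ⟨_, hg, ?_⟩
    rw [LinearMap.comp_apply]
    funext τ
    by_cases h : τ ∈ K.faces ∧ τ ⊆ ω ∧ (τ.card : ℤ) = j + 1
    · rw [restrict_of_mem ((hmem τ).2 ⟨h.1, h.2.1⟩)]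
      exact ((extendCochain_coe _ ⟨τ, h⟩).trans (redCoboundary_apply_eq g ⟨τ, h⟩)).symm
    · rw [extendCochain_of_not _ h]
      by_contra hne
      obtain ⟨h1, h2⟩ := restrict_coboundary_mem_cochains hg τ hne
      exact h ⟨((hmem τ).1 h1).1, ((hmem τ).1 h1).2, h2⟩
  have e1 := (Submodule.finrank_mono hZ).trans (Submodule.finrank_map_le _ _)
  have e2 := Submodule.finrank_mono hB
  rw [(Submodule.equivMapOfInjective _ (extendCochain_injective j) _).finrank_eq.symm] at e2
  have e3 := Submodule.finrank_quotient_add_finrank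
    (Submodule.comap (LinearMap.ker (redCoboundary K ω k j (j + 1))).subtype
      (Submodule.map (redCoboundary K ω k (j - 1) j) ⊤))
  have e4 : Module.finrank k
      (Submodule.comap (LinearMap.ker (redCoboundary K ω k j (j + 1))).subtype
        (Submodule.map (redCoboundary K ω k (j - 1) j) ⊤)) ≤
      Module.finrank k (Submodule.map (redCoboundary K ω k (j - 1) j) ⊤) := by
    rw [← Submodule.finrank_map_subtype_eq, Submodule.map_comap_subtype]
    exact Submodule.finrank_mono inf_le_right
  unfold betti redBetti redCohomology
  omega

end Comparison

theorem exists_face_card_eq_dimAdd1 (K : SimplicialComplexOn m) :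
    ∃ σ ∈ K.faces, σ.card = K.dimAdd1 ∧ ∀ τ ∈ K.faces, σ ⊆ τ → τ = σ := by
  have hbdd : BddAbove {n : ℕ | ∃ σ ∈ K.faces, σ.card = n} := by
    refine ⟨m, ?_⟩
    rintro _ ⟨σ, -, rfl⟩
    exact card_finset_fin_le σ
  have hne : {n : ℕ | ∃ σ ∈ K.faces, σ.card = n}.Nonempty := ⟨0, ∅, K.empty_mem, rfl⟩
  obtain ⟨σ, hσ, hcard⟩ := Nat.sSup_mem hne hbdd
  refine ⟨σ, hσ, hcard, fun τ hτ h => (Finset.eq_of_subset_of_card_le h ?_).symm⟩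
  rw [hcard]
  exact le_csSup hbdd ⟨τ, hτ, rfl⟩

end ColoredBound

/-- **Colored lower bound theorem.** Let `K` be a simplicial complex on `[m]`,
`k` a field, and `α` a partition of `[m]` into `r` blocks that is nondegenerate
for `K`.  For every `q ≥ 0`,
`Σ_{L ⊆ [r]} dim_k H̃^{|L|−q−1}(K|_{ω_L}; k) ≥ C(r − dim K − 1, q)`. -/
theorem sum_redBetti_ge_choose {m r : ℕ} (K : SimplicialComplexOn m)
    (k : Type*) [Field k] (c : Fin m → Fin r) (hc : Function.Surjective c)
    (hnd : IsNondegenerate K c) (q : ℕ) :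
    (r - K.dimAdd1).choose q ≤
      ∑ L : Finset (Fin r), redBetti K (omegaOf c L) k ((L.card : ℤ) - q - 1) := by
  obtain ⟨σ, hσ, hcard, hmax⟩ := ColoredBound.exists_face_card_eq_dimAdd1 K
  rw [← hcard]
  refine (ColoredBound.choose_le_sum_betti_starIn k hnd q hσ hmax).trans
    ((ColoredBound.sum_betti_starIn_le k hnd q σ hσ).trans (Finset.sum_le_sum fun M _ => ?_))
  have h := ColoredBound.betti_le_redBetti (K := K) (k := k) c M ((M.card : ℤ) - q - 1)
  rwa [sub_add_cancel] at h
end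

section
/- Let M be a finitely generated Z^r-multigraded module over the polynomial ring k[u₁,…,u_r] (k a field) of Krull dimension s. Then dim_k Tor_i^{k[u₁,…,u_r]}(k, M) ≥ C(r − s, i) for every i ≥ 0. -/
open CategoryTheory
open scoped TensorProduct

section TensorPolynomial

variable {S R : Type*} [CommRing S] [CommRing R] [Algebra S R]

theorem Module.Projective.restrictScalars_of_projective [Module.Free S R]
    (P : Type*) [AddCommGroup P] [Module R P] [Module S P] [IsScalarTower S R P]
    [Module.Projective R P] : Module.Projective S P := by
  classical
  obtain ⟨s, hs⟩ := Module.projective_def.mp (inferInstance : Module.Projective R P)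
  exact Module.Projective.of_split (s.restrictScalars S)
    ((Finsupp.linearCombination R (id : P → P)).restrictScalars S) (LinearMap.ext hs)

variable {K P : Type*} [AddCommGroup K] [Module S K]
  [AddCommGroup P] [Module R P] [Module S P] [IsScalarTower S R P]

theorem exists_leftInverse_lsmul_of_projective [Module.Projective R P] (x : R) (ρ : R →ₗ[S] R)
    (hρ : ∀ r, ρ (x * r) = r) : ∃ L : P →ₗ[S] P, ∀ p, L (x • p) = p := by
  obtain ⟨s, hs⟩ := Module.projective_def.mp (inferInstance : Module.Projective R P)
  refine ⟨((Finsupp.linearCombination R (id : P → P)).restrictScalars S) ∘ₗ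
    (Finsupp.mapRange.linearMap ρ) ∘ₗ (s.restrictScalars S), fun p ↦ ?_⟩
  have : Finsupp.mapRange.linearMap (α := P) ρ (x • s p) = s p := by
    ext q
    simp [hρ]
  simp [this, hs p]

theorem lTensor_lsmul_injective_of_projective [Module.Projective R P] (x : R) (ρ : R →ₗ[S] R)
    (hρ : ∀ r, ρ (x * r) = r) :
    Function.Injective ((Module.toModuleEnd S (S := R) P x).lTensor K) := by
  obtain ⟨L, hL⟩ := exists_leftInverse_lsmul_of_projective (S := S) (P := P) x ρ hρ
  refine Function.LeftInverse.injective (g := L.lTensor K) fun t ↦ ?_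
  rw [← LinearMap.lTensor_comp_apply]
  have : L ∘ₗ Module.toModuleEnd S (S := R) P x = LinearMap.id := LinearMap.ext hL
  rw [this, LinearMap.lTensor_id, LinearMap.id_apply]

theorem exact_lTensor_lsmul_mapOfCompatibleSMul [Module R K] [IsScalarTower S R K] (x : R)
    (hx : ∀ r : R, ∃ (s : S) (r' : R), r = algebraMap S R s + x * r')
    (hK : ∀ a : K, x • a = 0) :
    Function.Exact ((Module.toModuleEnd S (S := R) P x).lTensor K)
      (TensorProduct.mapOfCompatibleSMul R S S K P) := by
  rw [LinearMap.exact_iff]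
  refine le_antisymm ?_ ?_
  · intro t ht
    let W := LinearMap.range ((Module.toModuleEnd S (S := R) P x).lTensor K)
    let B : K →+ P →+ (K ⊗[S] P) ⧸ W :=
      { toFun a := W.mkQ.toAddMonoidHom.comp (TensorProduct.mk S K P a).toAddMonoidHom
        map_zero' := by ext; simp
        map_add' a b := by ext; simp }
    have hB : ∀ (r : R) (a : K) (p : P), B (r • a) p = B a (r • p) := by
      intro r a p
      obtain ⟨s, r', rfl⟩ := hx r
      have h1 : (algebraMap S R s + x * r') • a = s • a := by
        rw [add_smul, mul_smul, hK, add_zero, algebraMap_smul]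
      rw [h1]
      refine (Submodule.Quotient.eq W).2 ⟨-(a ⊗ₜ (r' • p)), ?_⟩
      simp [add_smul, TensorProduct.tmul_add, mul_smul]
    have key : ∀ t : K ⊗[S] P, TensorProduct.liftAddHom B hB
        (TensorProduct.mapOfCompatibleSMul R S S K P t) = W.mkQ t := by
      intro t
      induction t with
      | zero => simp
      | add a b ha hb => simp only [map_add, ha, hb]
      | tmul a p => rfl
    have := key t
    rw [LinearMap.mem_ker.mp ht, map_zero] at this
    exact (Submodule.Quotient.mk_eq_zero W).1 this.symm
  · rintro _ ⟨t, rfl⟩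
    induction t with
    | zero => simp
    | add a b ha hb => simpa using add_mem ha hb
    | tmul a p =>
      have : a ⊗ₜ[R] (x • p) = 0 := by rw [← TensorProduct.smul_tmul, hK, TensorProduct.zero_tmul]
      simpa using this

end TensorPolynomial

section TorLongExact

variable (S R : Type) [CommRing S] [CommRing R] [Algebra S R]

/-- Restriction of scalars along the structure map of an algebra. -/
noncomputable abbrev resScalars : ModuleCat.{0} R ⥤ ModuleCat.{0} S :=
  ModuleCat.restrictScalars (algebraMap S R)

variable {S R}

instance resScalars_isScalarTower (M : ModuleCat.{0} R) :
    IsScalarTower S R ((resScalars S R).obj M) :=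
  ⟨fun s r m ↦ by rw [Algebra.smul_def, mul_smul]; rfl⟩

instance resScalars_preservesProjectiveObjects [Module.Free S R] :
    (resScalars S R).PreservesProjectiveObjects where
  projective_obj {P} hP := by
    have h1 : Module.Projective R ((resScalars S R).obj P) :=
      (IsProjective.iff_projective (R := R) P).mpr hP
    exact (IsProjective.iff_projective ((resScalars S R).obj P)).mp
      (Module.Projective.restrictScalars_of_projective (S := S) (R := R)
        ((resScalars S R).obj P))

/-- The comparison `K ⊗[S] M ⟶ K ⊗[R] M` for `R`-modules `K` and `M`, natural in `M`. -/
noncomputable def tensorResScalars (K : ModuleCat.{0} R) :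
    resScalars S R ⋙ (MonoidalCategory.tensoringLeft (ModuleCat S)).obj ((resScalars S R).obj K) ⟶
    (MonoidalCategory.tensoringLeft (ModuleCat R)).obj K ⋙ resScalars S R where
  app M := ModuleCat.ofHom
    (X := TensorProduct S ((resScalars S R).obj K) ((resScalars S R).obj M))
    (Y := (resScalars S R).obj (ModuleCat.of R (TensorProduct R K M)))
    { toFun := (TensorProduct.mapOfCompatibleSMul R S S
        ((resScalars S R).obj K) ((resScalars S R).obj M))
      map_add' := map_add _
      map_smul' s t := by
        rw [map_smul, ← algebraMap_smul R s]
        rfl }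
  naturality M N f := by
    ext t
    induction t using TensorProduct.induction_on with
    | zero => simp
    | add a b ha hb => simp only [map_add, ha, hb]
    | tmul a m => rfl

theorem shortExact_tensorResScalars [Module.Free S R] (x : R) (ρ : R →ₗ[S] R)
    (hρ : ∀ r, ρ (x * r) = r) (hx : ∀ r : R, ∃ (s : S) (r' : R), r = algebraMap S R s + x * r')
    (K : ModuleCat.{0} R) (hK : ∀ a : K, x • a = 0) (P : ModuleCat.{0} R) [Projective P] :
    ∃ w, (ShortComplex.mk
      ((resScalars S R ⋙ (MonoidalCategory.tensoringLeft (ModuleCat S)).obj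
        ((resScalars S R).obj K)).map (x • 𝟙 P))
      ((tensorResScalars (S := S) K).app P) w).ShortExact := by
  have h1 : Module.Projective R ((resScalars S R).obj P) :=
      (IsProjective.iff_projective (R := R) P).mpr inferInstance
  have hex := exact_lTensor_lsmul_mapOfCompatibleSMul (S := S) (R := R)
    (K := (resScalars S R).obj K) (P := (resScalars S R).obj P) x hx hK
  have hinj := lTensor_lsmul_injective_of_projective (S := S) (R := R)
    (K := (resScalars S R).obj K) (P := (resScalars S R).obj P) x ρ hρ
  have hsurj := TensorProduct.mapOfCompatibleSMul_surjective R S S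
    ((resScalars S R).obj K) ((resScalars S R).obj P)
  refine ⟨?_, { exact := ?_, mono_f := ?_, epi_g := ?_ }⟩
  · ext t
    exact hex.apply_apply_eq_zero t
  · exact (ShortComplex.ShortExact.moduleCat_exact_iff_function_exact _).mpr hex
  · exact (ModuleCat.mono_iff_injective _).mpr hinj
  · exact (ModuleCat.epi_iff_surjective _).mpr hsurj

/-- The complex `K ⊗[S] P`, for `K` an `R`-module and `P` a complex of `R`-modules. -/
noncomputable abbrev tensorResComplex (K : ModuleCat.{0} R) (P : ChainComplex (ModuleCat.{0} R) ℕ) :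
    ChainComplex (ModuleCat.{0} S) ℕ :=
  (((MonoidalCategory.tensoringLeft (ModuleCat S)).obj
    ((resScalars S R).obj K)).mapHomologicalComplex _).obj
    (((resScalars S R).mapHomologicalComplex _).obj P)

/-- The sequence `0 ⟶ K ⊗[S] P ⟶ K ⊗[S] P ⟶ K ⊗[R] P ⟶ 0` given by multiplication by `x`. -/
theorem shortExact_complex [Module.Free S R] (x : R) (ρ : R →ₗ[S] R)
    (hρ : ∀ r, ρ (x * r) = r) (hx : ∀ r : R, ∃ (s : S) (r' : R), r = algebraMap S R s + x * r')
    (K : ModuleCat.{0} R) (hK : ∀ a : K, x • a = 0) (P : ChainComplex (ModuleCat.{0} R) ℕ)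
    [∀ i, Projective (P.X i)] :
    ∃ (g : tensorResComplex (S := S) K P ⟶
      ((resScalars S R).mapHomologicalComplex _).obj
        ((((MonoidalCategory.tensoringLeft (ModuleCat R)).obj K).mapHomologicalComplex _).obj P))
      (w : _),
      (ShortComplex.mk ((((MonoidalCategory.tensoringLeft (ModuleCat S)).obj
        ((resScalars S R).obj K)).mapHomologicalComplex _).map
        (((resScalars S R).mapHomologicalComplex _).map (x • 𝟙 P))) g w).ShortExact := by
  let g : tensorResComplex (S := S) K P ⟶
      ((resScalars S R).mapHomologicalComplex _).obj
        ((((MonoidalCategory.tensoringLeft (ModuleCat R)).obj K).mapHomologicalComplex _).obj P) :=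
    (NatTrans.mapHomologicalComplex (tensorResScalars (S := S) K) _).app P
  have h (i : ℕ) := shortExact_tensorResScalars x ρ hρ hx K hK (P.X i)
  refine ⟨g, ?_, ?_⟩
  · ext i : 1
    exact (h i).choose
  · refine HomologicalComplex.shortExact_of_degreewise_shortExact _ fun i ↦ ?_
    exact (h i).choose_spec

end TorLongExact

section RankLinear

variable {k : Type} [Field k] {A B C : Type} [AddCommGroup A] [Module k A] [AddCommGroup B]
  [Module k B] [AddCommGroup C] [Module k C]

theorem rank_quotient_range_le_of_exact {x : A →ₗ[k] A} {g : A →ₗ[k] B} (h : Function.Exact x g) :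
    Module.rank k (A ⧸ LinearMap.range x) ≤ Module.rank k B := by
  rw [← LinearMap.exact_iff.mp h, (g.quotKerEquivRange).rank_eq]
  exact Submodule.rank_le _

theorem rank_quotient_range_add_rank_ker_le_of_exact {x : A →ₗ[k] A} {g : A →ₗ[k] B}
    {δ : B →ₗ[k] C} {y : C →ₗ[k] C} (h₁ : Function.Exact x g) (h₂ : Function.Exact g δ)
    (h₃ : Function.Exact δ y) :
    Module.rank k (A ⧸ LinearMap.range x) + Module.rank k (LinearMap.ker y) ≤
      Module.rank k B := by
  rw [← LinearMap.exact_iff.mp h₁, (g.quotKerEquivRange).rank_eq, LinearMap.exact_iff.mp h₃,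
    ← LinearMap.exact_iff.mp h₂, add_comm, LinearMap.rank_range_add_rank_ker]

end RankLinear

section TorRank

variable {k S R : Type} [Field k] [CommRing S] [CommRing R] [Algebra S R] [Algebra k S]
  [Algebra k R] [IsScalarTower k S R]

variable (k S) in
/-- `Tor_i^S(K, -)` with values in vector spaces over `k`. -/
noncomputable abbrev torFunctor (K : ModuleCat.{0} S) (i : ℕ) : ModuleCat.{0} S ⥤ ModuleCat.{0} k :=
  (Tor (ModuleCat S) i).obj K ⋙ resScalars k S

theorem exact_hom_of_iso {A B C A' B' C' : ModuleCat.{0} S} (a : A ≅ A') (b : B ≅ B') (c : C ≅ C')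
    {f : A ⟶ B} {g : B ⟶ C} {f' : A' ⟶ B'} {g' : B' ⟶ C'} (h₁ : f ≫ b.hom = a.hom ≫ f')
    (h₂ : g ≫ c.hom = b.hom ≫ g') (h : Function.Exact f'.hom g'.hom) :
    Function.Exact f.hom g.hom :=
  (Function.Exact.iff_of_ladder_linearEquiv (e₁ := a.toLinearEquiv) (e₂ := b.toLinearEquiv)
    (e₃ := c.toLinearEquiv) (congrArg ModuleCat.Hom.hom h₁).symm
    (congrArg ModuleCat.Hom.hom h₂).symm).mp h

theorem comp_inv_comp_hom {C : Type*} [Category C] {W X Y Z : C} (f : W ⟶ X) (g : X ⟶ Y)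
    (e : Z ≅ Y) : (f ≫ g ≫ e.inv) ≫ e.hom = f ≫ g := by
  simp

theorem exists_tor_longExact [Module.Free S R] (x : R) (ρ : R →ₗ[S] R)
    (hρ : ∀ r, ρ (x * r) = r) (hx : ∀ r : R, ∃ (s : S) (r' : R), r = algebraMap S R s + x * r')
    (K : ModuleCat.{0} R) (hK : ∀ a : K, x • a = 0) (M : ModuleCat.{0} R) :
    ∃ (g : ∀ i, ((Tor (ModuleCat S) i).obj ((resScalars S R).obj K)).obj ((resScalars S R).obj M) ⟶
        (resScalars S R).obj (((Tor (ModuleCat R) i).obj K).obj M))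
      (δ : ∀ i, (resScalars S R).obj (((Tor (ModuleCat R) (i + 1)).obj K).obj M) ⟶
        ((Tor (ModuleCat S) i).obj ((resScalars S R).obj K)).obj ((resScalars S R).obj M)),
      (∀ i, Function.Exact (((Tor (ModuleCat S) i).obj ((resScalars S R).obj K)).map
        ((resScalars S R).map (x • 𝟙 M))).hom (g i).hom) ∧
      (∀ i, Function.Exact (g (i + 1)).hom (δ i).hom) ∧
      (∀ i, Function.Exact (δ i).hom (((Tor (ModuleCat S) i).obj ((resScalars S R).obj K)).map
        ((resScalars S R).map (x • 𝟙 M))).hom) := by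
  let P := projectiveResolution M
  obtain ⟨g, w, hS⟩ := shortExact_complex x ρ hρ hx K hK P.complex
  let T := (MonoidalCategory.tensoringLeft (ModuleCat S)).obj ((resScalars S R).obj K)
  let P' := (resScalars S R).mapProjectiveResolution P
  let φ : P'.complex ⟶ P'.complex :=
    ((resScalars S R).mapHomologicalComplex _).map (x • 𝟙 P.complex)
  let e₁ (i : ℕ) := P'.isoLeftDerivedObj T i
  have comm' : φ ≫ P'.π = P'.π ≫
      (ChainComplex.single₀ _).map ((resScalars S R).map (x • 𝟙 M)) := by
    have h₁ : (x • 𝟙 P.complex) ≫ P.π =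
        P.π ≫ (HomologicalComplex.single _ (ComplexShape.down ℕ) 0).map (x • 𝟙 M) := by
      have : (HomologicalComplex.single _ (ComplexShape.down ℕ) 0).map (x • 𝟙 M) = x • 𝟙 _ := by
        ext
        simp [HomologicalComplex.single_map_f_self]
        rfl
      rw [this, Linear.smul_comp, Linear.comp_smul, Category.id_comp, Category.comp_id]
    have h₂ := (HomologicalComplex.singleMapHomologicalComplex (resScalars S R)
      (ComplexShape.down ℕ) 0).hom.naturality (x • 𝟙 M)
    let F := (resScalars S R).mapHomologicalComplex (ComplexShape.down ℕ)
    let α := (HomologicalComplex.singleMapHomologicalComplex (resScalars S R)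
      (ComplexShape.down ℕ) 0).hom.app M
    have h₃ : F.map (x • 𝟙 P.complex) ≫ F.map P.π =
        F.map P.π ≫ F.map ((HomologicalComplex.single _ (ComplexShape.down ℕ) 0).map (x • 𝟙 M)) :=
      (F.map_comp _ _).symm.trans ((congrArg F.map h₁).trans (F.map_comp _ _))
    exact (Category.assoc _ _ _).symm.trans ((congrArg (· ≫ α) h₃).trans
      ((Category.assoc _ _ _).trans ((congrArg (F.map P.π ≫ ·) h₂).trans
        (Category.assoc _ _ _).symm)))
  have comm : φ.f 0 ≫ P'.π.f 0 = P'.π.f 0 ≫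
      ((ChainComplex.single₀ _).map ((resScalars S R).map (x • 𝟙 M))).f 0 :=
    HomologicalComplex.congr_hom comm' 0
  have hnat (i : ℕ) := ProjectiveResolution.isoLeftDerivedObj_hom_naturality
    ((resScalars S R).map (x • 𝟙 M)) P' P' φ comm T i
  let e₃ (i : ℕ) : (resScalars S R).obj (((Tor (ModuleCat R) i).obj K).obj M) ≅
      (((resScalars S R).mapHomologicalComplex _).obj
        ((((MonoidalCategory.tensoringLeft (ModuleCat R)).obj K).mapHomologicalComplex
          _).obj P.complex)).homology i :=
    (resScalars S R).mapIso (P.isoLeftDerivedObj _ i) ≪≫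
      (ShortComplex.mapHomologyIso _ (resScalars S R)).symm
  refine ⟨fun i ↦ (e₁ i).hom ≫ HomologicalComplex.homologyMap g i ≫ (e₃ i).inv,
    fun i ↦ (e₃ (i + 1)).hom ≫ hS.δ (i + 1) i rfl ≫ (e₁ i).inv, fun i ↦ ?_, fun i ↦ ?_, fun i ↦ ?_⟩
  · refine exact_hom_of_iso (e₁ i) (e₁ i) (e₃ i) (hnat i) ?_
      ((ShortComplex.ShortExact.moduleCat_exact_iff_function_exact _).mp (hS.homology_exact₂ i))
    exact comp_inv_comp_hom _ _ _
  · refine exact_hom_of_iso (e₁ (i + 1)) (e₃ (i + 1)) (e₁ i) ?_ ?_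
      ((ShortComplex.ShortExact.moduleCat_exact_iff_function_exact _).mp
        (hS.homology_exact₃ (i + 1) i rfl))
    · exact comp_inv_comp_hom _ _ _
    · exact comp_inv_comp_hom _ _ _
  · refine exact_hom_of_iso (e₃ (i + 1)) (e₁ i) (e₁ i) ?_ (hnat i)
      ((ShortComplex.ShortExact.moduleCat_exact_iff_function_exact _).mp
        (hS.homology_exact₁ (i + 1) i rfl))
    exact comp_inv_comp_hom _ _ _

end TorRank

section TorRankBounds

variable {k S R : Type} [Field k] [CommRing S] [CommRing R] [Algebra S R] [Algebra k S]
  [Algebra k R] [IsScalarTower k S R]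

theorem rank_resScalars_resScalars (T : ModuleCat.{0} R) :
    Module.rank k ((resScalars k S).obj ((resScalars S R).obj T)) =
      Module.rank k ((resScalars k R).obj T) :=
  LinearEquiv.rank_eq
    { toFun := fun t ↦ t
      invFun := fun t ↦ t
      left_inv := fun _ ↦ rfl
      right_inv := fun _ ↦ rfl
      map_add' := fun _ _ ↦ rfl
      map_smul' := fun c t ↦ congrArg (fun r : R ↦ (r • (show T from t) : T))
        (IsScalarTower.algebraMap_apply k S R c).symm }

variable [Module.Free S R] (x : R) (ρ : R →ₗ[S] R) (hρ : ∀ r, ρ (x * r) = r)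
  (hx : ∀ r : R, ∃ (s : S) (r' : R), r = algebraMap S R s + x * r')
  (K : ModuleCat.{0} R) (hK : ∀ a : K, x • a = 0) (M : ModuleCat.{0} R)

include hρ hx hK

theorem rank_coker_tor_le (i : ℕ) :
    Module.rank k ((torFunctor k S ((resScalars S R).obj K) i).obj ((resScalars S R).obj M) ⧸
      LinearMap.range ((torFunctor k S ((resScalars S R).obj K) i).map
        ((resScalars S R).map (x • 𝟙 M))).hom) ≤
    Module.rank k ((resScalars k R).obj (((Tor (ModuleCat R) i).obj K).obj M)) := by
  obtain ⟨g, -, h, -, -⟩ := exists_tor_longExact x ρ hρ hx K hK M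
  rw [← rank_resScalars_resScalars (S := S)]
  exact rank_quotient_range_le_of_exact (g := ((resScalars k S).map (g i)).hom) (h i)

theorem rank_coker_tor_add_rank_ker_tor_le (i : ℕ) :
    Module.rank k ((torFunctor k S ((resScalars S R).obj K) (i + 1)).obj
        ((resScalars S R).obj M) ⧸
      LinearMap.range ((torFunctor k S ((resScalars S R).obj K) (i + 1)).map
        ((resScalars S R).map (x • 𝟙 M))).hom) +
    Module.rank k (LinearMap.ker ((torFunctor k S ((resScalars S R).obj K) i).map
        ((resScalars S R).map (x • 𝟙 M))).hom) ≤
    Module.rank k ((resScalars k R).obj (((Tor (ModuleCat R) (i + 1)).obj K).obj M)) := by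
  obtain ⟨g, δ, h₁, h₂, h₃⟩ := exists_tor_longExact x ρ hρ hx K hK M
  rw [← rank_resScalars_resScalars (S := S)]
  exact rank_quotient_range_add_rank_ker_le_of_exact (g := ((resScalars k S).map (g (i + 1))).hom)
    (δ := ((resScalars k S).map (δ i)).hom) (h₁ (i + 1)) (h₂ i) (h₃ i)

end TorRankBounds

section GradedRank

variable {k : Type} [Field k] {H : Type} [AddCommGroup H] [Module k H] {T : ℤ → Type}
  [∀ j, AddCommGroup (T j)] [∀ j, Module k (T j)]

/-- If `H` has graded pieces `T j`, vanishing for small `j`, and `x` is an endomorphism of `H` of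
degree one, then no piece is larger than the cokernel of `x`. -/
theorem rank_piece_le_rank_coker (x : H →ₗ[k] H) (ι : ∀ j, T j →ₗ[k] H) (π : ∀ j, H →ₗ[k] T j)
    (τ : ∀ j, T j →ₗ[k] T (j + 1)) (hπι : ∀ j t, π j (ι j t) = t)
    (hπι' : ∀ j l t, j ≠ l → π l (ι j t) = 0) (hπx : ∀ j h, π (j + 1) (x h) = τ j (π j h))
    (a : ℤ) (ha : ∀ j ≤ a, Subsingleton (T j)) (J : ℤ) :
    Module.rank k (T J) ≤ Module.rank k (H ⧸ LinearMap.range x) := by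
  suffices h : a ≤ J → ∃ W : Submodule k H, (∀ w ∈ W, ∀ l, J < l → π l w = 0) ∧
      Disjoint W (LinearMap.range x) ∧ Module.rank k (T J) ≤ Module.rank k W by
    rcases le_total J a with hJ | hJ
    · have := ha J hJ
      rw [rank_subsingleton']
      exact zero_le
    · obtain ⟨W, -, hd, hW⟩ := h hJ
      refine hW.trans (LinearMap.rank_le_of_injective ((LinearMap.range x).mkQ ∘ₗ W.subtype) ?_)
      rw [← LinearMap.ker_eq_bot, LinearMap.ker_comp, Submodule.ker_mkQ,
        ← Submodule.disjoint_iff_comap_eq_bot]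
      exact hd
  intro hJ
  induction J, hJ using Int.leInduction with
  | base =>
    have := ha a le_rfl
    exact ⟨⊥, by simp, disjoint_bot_left, by rw [rank_subsingleton']; exact zero_le⟩
  | succ J hJ ih =>
    obtain ⟨W, hW, hd, hr⟩ := ih
    obtain ⟨C, hC⟩ := Submodule.exists_isCompl (LinearMap.range (τ J))
    have hι : Function.Injective (ι (J + 1)) := Function.LeftInverse.injective (hπι (J + 1))
    have hWC : Disjoint W (C.map (ι (J + 1))) := by
      rw [Submodule.disjoint_def]
      rintro _ hw ⟨c, hc, rfl⟩
      have := hW _ hw (J + 1) (by omega)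
      rw [hπι] at this
      rw [this, map_zero]
    refine ⟨W ⊔ C.map (ι (J + 1)), ?_, ?_, ?_⟩
    · intro w hw l hl
      obtain ⟨w, hwW, _, ⟨c, hc, rfl⟩, rfl⟩ := Submodule.mem_sup.mp hw
      rw [map_add, hW w hwW l (by omega), hπι' _ _ _ (by omega), add_zero]
    · rw [Submodule.disjoint_def]
      intro w hw hx
      obtain ⟨w, hwW, _, ⟨c, hc, rfl⟩, rfl⟩ := Submodule.mem_sup.mp hw
      have hx' := hx
      obtain ⟨h, hh⟩ := hx
      have h1 := hπx J h
      rw [hh, map_add, hW w hwW _ (by omega), hπι, zero_add] at h1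
      have h0 : c = 0 := Submodule.disjoint_def.mp hC.disjoint c ⟨_, h1.symm⟩ hc
      subst h0
      rw [map_zero, add_zero] at hx' ⊢
      exact Submodule.disjoint_def.mp hd w hwW hx'
    · have h1 := Submodule.rank_sup_add_rank_inf_eq W (C.map (ι (J + 1)))
      rw [hWC.eq_bot, rank_bot, add_zero,
        (Submodule.equivMapOfInjective _ hι C).rank_eq.symm] at h1
      have h2 := Submodule.rank_sup_add_rank_inf_eq (LinearMap.range (τ J)) C
      rw [hC.disjoint.eq_bot, rank_bot, add_zero, hC.sup_eq_top, rank_top] at h2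
      rw [h1, h2]
      gcongr
      exact (rank_range_le _).trans hr

end GradedRank

theorem leftDerived_additive {C D : Type*} [Category C] [Category D] [Abelian C] [Abelian D]
    [HasProjectiveResolutions C] (F : C ⥤ D) [F.Additive] (n : ℕ) : (F.leftDerived n).Additive where
  map_add {X Y f g} := by
    let P := projectiveResolution X
    let Q := projectiveResolution Y
    have hf := ProjectiveResolution.lift_commutes f P Q
    have hg := ProjectiveResolution.lift_commutes g P Q
    have hfg : (ProjectiveResolution.lift f P Q + ProjectiveResolution.lift g P Q) ≫ Q.π =
        P.π ≫ (ChainComplex.single₀ C).map (f + g) := by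
      rw [Preadditive.add_comp, hf, hg, Functor.map_add, Preadditive.comp_add]
    rw [F.leftDerived_map_eq n f _ hf, F.leftDerived_map_eq n g _ hg,
      F.leftDerived_map_eq n (f + g) _ hfg, Functor.map_add, Preadditive.add_comp,
      Preadditive.comp_add]

section GradedFunctor

variable {k S : Type} [Field k] [CommRing S] (G : ModuleCat.{0} S ⥤ ModuleCat.{0} k)
  [G.Additive]

theorem rank_obj_le_rank_coker_map {H : ModuleCat.{0} S} (ξ : H ⟶ H) (N : ℤ → ModuleCat.{0} S)
    (ι : ∀ j, N j ⟶ H) (π : ∀ j, H ⟶ N j) (τ : ∀ j, N j ⟶ N (j + 1))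
    (hιπ : ∀ j, ι j ≫ π j = 𝟙 _) (hιπ' : ∀ j l, j ≠ l → ι j ≫ π l = 0)
    (hξ : ∀ j, ξ ≫ π (j + 1) = π j ≫ τ j) (a : ℤ) (ha : ∀ j ≤ a, Subsingleton (N j)) (J : ℤ) :
    Module.rank k (G.obj (N J)) ≤ Module.rank k (G.obj H ⧸ LinearMap.range (G.map ξ).hom) := by
  refine rank_piece_le_rank_coker (T := fun j ↦ G.obj (N j)) (G.map ξ).hom
    (fun j ↦ (G.map (ι j)).hom) (fun j ↦ (G.map (π j)).hom) (fun j ↦ (G.map (τ j)).hom)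
    (fun j t ↦ ?_) (fun j l t h ↦ ?_) (fun j h ↦ ?_) a (fun j hj ↦ ?_) J
  · rw [← ModuleCat.comp_apply, ← G.map_comp, hιπ, G.map_id]
    rfl
  · rw [← ModuleCat.comp_apply, ← G.map_comp, hιπ' j l h, G.map_zero]
    rfl
  · rw [← ModuleCat.comp_apply, ← ModuleCat.comp_apply, ← G.map_comp, ← G.map_comp, hξ]
  · have := ha j hj
    exact ModuleCat.subsingleton_of_isZero
      (G.map_isZero (ModuleCat.isZero_of_subsingleton (N j)))

theorem rank_obj_le_rank_ker_map {H N : ModuleCat.{0} S} (ξ : H ⟶ H) (ι : N ⟶ H) (π : H ⟶ N)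
    (hιπ : ι ≫ π = 𝟙 _) (hξ : ι ≫ ξ = 0) :
    Module.rank k (G.obj N) ≤ Module.rank k (LinearMap.ker (G.map ξ).hom) := by
  refine LinearMap.rank_le_of_injective ((G.map ι).hom.codRestrict _ fun t ↦ ?_) ?_
  · rw [LinearMap.mem_ker, ← ModuleCat.comp_apply, ← G.map_comp, hξ, G.map_zero]
    rfl
  · rw [LinearMap.injective_codRestrict_iff]
    refine Function.LeftInverse.injective (g := (G.map π).hom) fun t ↦ ?_
    rw [← ModuleCat.comp_apply, ← G.map_comp, hιπ, G.map_id]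
    rfl

end GradedFunctor

section InternalProjection

variable {S M : Type*} [CommRing S] [AddCommGroup M] [Module S M] {N : ℤ → Submodule S M}

/-- The projection of an internal direct sum onto one of its summands. -/
noncomputable def internalProj (h : DirectSum.IsInternal N) (j : ℤ) : M →ₗ[S] N j :=
  DirectSum.component S ℤ (fun l ↦ N l) j ∘ₗ
    (LinearEquiv.ofBijective (DirectSum.coeLinearMap N) h).symm.toLinearMap

variable (h : DirectSum.IsInternal N)

theorem internalProj_apply_of_mem {j : ℤ} {m : M} (hm : m ∈ N j) :
    internalProj h j m = ⟨m, hm⟩ :=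
  h.ofBijective_coeLinearMap_same ⟨m, hm⟩

theorem internalProj_apply_of_ne {j l : ℤ} (hjl : j ≠ l) {m : M} (hm : m ∈ N j) :
    internalProj h l m = 0 :=
  h.ofBijective_coeLinearMap_of_ne hjl ⟨m, hm⟩

theorem finite_internalProj_ne_zero (m : M) : {j | internalProj h j m ≠ 0}.Finite :=
  DFinsupp.finite_support _

include h in
theorem internal_induction {p : M → Prop} (hmem : ∀ j, ∀ m ∈ N j, p m)
    (hadd : ∀ m m', p m → p m' → p (m + m')) (m : M) : p m := by
  have hm : m ∈ ⨆ j, N j := h.submodule_iSup_eq_top ▸ Submodule.mem_top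
  exact Submodule.iSup_induction N (motive := p) hm hmem (hmem 0 0 (zero_mem _)) hadd

theorem internalProj_add_one_apply (f : M →ₗ[S] M) (hf : ∀ j, ∀ m ∈ N j, f m ∈ N (j + 1))
    (j : ℤ) (m : M) : (internalProj h (j + 1) (f m) : M) = f (internalProj h j m) := by
  induction m using internal_induction h with
  | hmem l m hm =>
    rcases eq_or_ne l j with rfl | hl
    · rw [internalProj_apply_of_mem h hm, internalProj_apply_of_mem h (hf _ _ hm)]
    · rw [internalProj_apply_of_ne h hl hm,
        internalProj_apply_of_ne h (by omega : l + 1 ≠ j + 1) (hf _ _ hm)]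
      simp
  | hadd m m' hm hm' => simp only [map_add, Submodule.coe_add, hm, hm']

end InternalProjection

section GradedPolynomialModule

open Polynomial

variable {S R M : Type*} [CommRing S] [CommRing R] [Algebra S R] [AddCommGroup M] [Module R M]
  [Module S M] [IsScalarTower S R M] (e : S[X] ≃ₐ[S] R)

include e in
theorem smul_mem_of_X_smul_mem {Q : Submodule S M} (hQ : ∀ m ∈ Q, e X • m ∈ Q) (r : R) {m : M}
    (hm : m ∈ Q) : r • m ∈ Q := by
  obtain ⟨p, rfl⟩ := e.surjective r
  induction p using Polynomial.induction_on' with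
  | add p q hp hq =>
    rw [map_add, add_smul]
    exact add_mem hp hq
  | monomial n s =>
    rw [← C_mul_X_pow_eq_monomial, map_mul, map_pow, mul_smul, ← algebraMap_eq,
      AlgEquiv.commutes, algebraMap_smul]
    refine Q.smul_mem s ?_
    induction n with
    | zero => simpa
    | succ n ih =>
      rw [pow_succ', mul_smul]
      exact hQ _ ih

include e in
theorem span_le_of_X_smul_mem {Q : Submodule S M} (hQ : ∀ m ∈ Q, e X • m ∈ Q) {T : Set M}
    (hT : T ⊆ Q) {m : M} (hm : m ∈ Submodule.span R T) : m ∈ Q := by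
  induction hm using Submodule.span_induction with
  | mem m hm => exact hT hm
  | zero => exact Q.zero_mem
  | add m m' _ _ hm hm' => exact Q.add_mem hm hm'
  | smul r m _ hm => exact smul_mem_of_X_smul_mem e hQ r hm

theorem algEquiv_divX_smul_add (p : S[X]) (m : M) :
    e X • e p.divX • m + p.coeff 0 • m = e p • m := by
  conv_rhs => rw [← divX_mul_X_add p]
  rw [map_add, map_mul, ← algebraMap_eq, AlgEquiv.commutes, add_smul, algebraMap_smul, mul_comm,
    mul_smul]

variable {N : ℤ → Submodule S M} (h : DirectSum.IsInternal N)
  (hX : ∀ j, ∀ m ∈ N j, e X • m ∈ N (j + 1))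

include hX in
theorem internalProj_X_smul (j : ℤ) (m : M) :
    (internalProj h j (e X • m) : M) = e X • (internalProj h (j - 1) m : M) := by
  have := internalProj_add_one_apply h (Module.toModuleEnd S (S := R) M (e X)) hX (j - 1) m
  rwa [sub_add_cancel] at this

/-- The elements all of whose components in degrees below `j` vanish. -/
noncomputable def degreeGE (j : ℤ) : Submodule S M :=
  ⨅ l : Set.Iio j, LinearMap.ker (internalProj h l)

theorem mem_degreeGE {j : ℤ} {m : M} :
    m ∈ degreeGE h j ↔ ∀ l < j, internalProj h l m = 0 := by
  simp [degreeGE]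

include hX in
theorem X_smul_mem_degreeGE {j : ℤ} {m : M} (hm : m ∈ degreeGE h j) :
    e X • m ∈ degreeGE h j := by
  rw [mem_degreeGE] at hm ⊢
  intro l hl
  rw [← Submodule.coe_eq_zero, internalProj_X_smul e h hX, hm _ (by omega)]
  simp

theorem mem_degreeGE_of_mem {j : ℤ} {m : M} (hm : m ∈ N j) : m ∈ degreeGE h j :=
  (mem_degreeGE h).mpr fun _ hl ↦ internalProj_apply_of_ne h hl.ne' hm

include hX in
theorem internalProj_algEquiv_smul (p : S[X]) {j : ℤ} {m : M} (hm : m ∈ N j) (a : ℕ) :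
    (internalProj h (j + a) (e p • m) : M) = p.coeff a • (e X) ^ a • m := by
  induction a generalizing p with
  | zero =>
    have h0 := smul_mem_of_X_smul_mem e (fun _ ↦ X_smul_mem_degreeGE e h hX) (e p.divX)
      (mem_degreeGE_of_mem h hm)
    rw [← algEquiv_divX_smul_add e p, map_add, map_smul _ (p.coeff 0),
      Submodule.coe_add, Submodule.coe_smul,
      internalProj_X_smul e h hX, (mem_degreeGE h).mp h0 _ (by simp),
      internalProj_apply_of_mem h (by simpa using hm)]
    simp
  | succ a ih =>
    have h1 : j + (a + 1 : ℕ) - 1 = j + a := by push_cast; ring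
    rw [← algEquiv_divX_smul_add e p, map_add, map_smul _ (p.coeff 0),
      Submodule.coe_add, Submodule.coe_smul,
      internalProj_X_smul e h hX, internalProj_apply_of_ne h (by omega) hm, h1, ih,
      coeff_divX, pow_succ', mul_smul, smul_comm (e X)]
    simp

include e h hX in
theorem ringKrullDim_quotient_annihilator_le (j : ℤ) :
    ringKrullDim (S ⧸ Module.annihilator S (N j)) ≤
      ringKrullDim (R ⧸ Module.annihilator R M) := by
  let φ : R →+* S ⧸ Module.annihilator S (N j) :=
    ((Ideal.Quotient.mk _).comp constantCoeff).comp (e.symm : R →+* S[X])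
  have hφ : Function.Surjective φ :=
    (Ideal.Quotient.mk_surjective.comp constantCoeff_surjective).comp e.symm.surjective
  refine ringKrullDim_le_of_surjective (Ideal.Quotient.lift _ φ fun r hr ↦ ?_)
    (Ideal.Quotient.lift_surjective_of_surjective _ _ hφ)
  obtain ⟨p, rfl⟩ := e.surjective r
  refine Ideal.Quotient.eq_zero_iff_mem.mpr (Module.mem_annihilator.mpr fun n ↦ Subtype.ext ?_)
  have := internalProj_algEquiv_smul e h hX p n.2 0
  rw [Module.mem_annihilator.mp hr] at this
  simpa using this.symm

variable [Module.Finite R M]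

include h in
theorem exists_finset_span_eq_top_internalProj (R : Type*) [CommRing R] [Module R M]
    [Module.Finite R M] : ∃ (T : Finset M) (a b : ℤ), Submodule.span R (T : Set M) = ⊤ ∧
      ∀ m ∈ T, ∀ j, j < a ∨ b < j → internalProj h j m = 0 := by
  obtain ⟨T, hT⟩ := Module.Finite.fg_top (R := R) (M := M)
  have hfin : (⋃ m ∈ T, {j | internalProj h j m ≠ 0}).Finite :=
    T.finite_toSet.biUnion fun m _ ↦ finite_internalProj_ne_zero h m
  obtain ⟨a, ha⟩ := hfin.bddBelow
  obtain ⟨b, hb⟩ := hfin.bddAbove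
  refine ⟨T, a, b, hT, fun m hm j hj ↦ ?_⟩
  by_contra hne
  have hmem : j ∈ ⋃ m ∈ T, {j | internalProj h j m ≠ 0} := Set.mem_biUnion hm hne
  have := ha hmem
  have := hb hmem
  omega

include e h hX in
theorem exists_forall_lt_eq_bot : ∃ a, ∀ j < a, N j = ⊥ := by
  obtain ⟨T, a, b, hT, hab⟩ := exists_finset_span_eq_top_internalProj h R
  refine ⟨a, fun j hj ↦ (Submodule.eq_bot_iff _).mpr fun m hm ↦ ?_⟩
  have := span_le_of_X_smul_mem e (Q := degreeGE h a) (fun _ ↦ X_smul_mem_degreeGE e h hX)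
    (fun m hm ↦ (mem_degreeGE h).mpr fun l hl ↦ hab m hm l (Or.inl hl))
    (hT ▸ Submodule.mem_top : m ∈ Submodule.span R (T : Set M))
  have := (mem_degreeGE h).mp this j hj
  rw [internalProj_apply_of_mem h hm] at this
  exact congrArg Subtype.val this

include e h hX in
theorem exists_forall_gt_X_smul : ∃ a, ∀ j > a, ∀ m ∈ N j, ∃ n ∈ N (j - 1), e X • n = m := by
  obtain ⟨T, a, b, hT, hab⟩ := exists_finset_span_eq_top_internalProj h R
  refine ⟨b, fun j hj m hm ↦ ?_⟩
  let Q : Submodule S M := ⨅ l : Set.Ioi b, ((N (l - 1)).map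
    (Module.toModuleEnd S (S := R) M (e X))).comap ((N l).subtype ∘ₗ internalProj h l)
  have hQ {m : M} : m ∈ Q ↔ ∀ l > b, ∃ n ∈ N (l - 1), e X • n = (internalProj h l m : M) := by
    simp [Q]
  have := span_le_of_X_smul_mem e (Q := Q)
    (fun m _ ↦ hQ.mpr fun l _ ↦ ⟨internalProj h (l - 1) m, Subtype.property _,
      (internalProj_X_smul e h hX l m).symm⟩)
    (fun m hm ↦ hQ.mpr fun l hl ↦ ⟨0, zero_mem _, by rw [hab m hm l (Or.inr hl)]; simp⟩)
    (hT ▸ Submodule.mem_top : m ∈ Submodule.span R (T : Set M))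
  have := hQ.mp this j hj
  rwa [internalProj_apply_of_mem h hm] at this

include e h hX in
theorem finite_of_internal [IsNoetherianRing R] (j : ℤ) : Module.Finite S (N j) := by
  obtain ⟨T, hTN, hT⟩ := (Submodule.fg_span_iff_fg_span_finset_subset (R := R) (N j : Set M)).mp
    (IsNoetherian.noetherian _)
  let Q : Submodule S M := degreeGE h j ⊓
    (Submodule.span S (T : Set M)).comap ((N j).subtype ∘ₗ internalProj h j)
  have hQ {m : M} (hm : m ∈ N j) : m ∈ Q := by
    refine span_le_of_X_smul_mem e (Q := Q) (T := T) (fun m hm ↦ ⟨?_, ?_⟩) (fun m hm ↦ ⟨?_, ?_⟩)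
      (hT ▸ Submodule.subset_span hm)
    · exact X_smul_mem_degreeGE e h hX hm.1
    · simp [internalProj_X_smul e h hX, (mem_degreeGE h).mp hm.1]
    · exact mem_degreeGE_of_mem h (hTN hm)
    · simpa [internalProj_apply_of_mem h (hTN hm)] using Submodule.subset_span hm
  refine Module.Finite.iff_fg.mpr ⟨T, le_antisymm (Submodule.span_le.mpr hTN) fun m hm ↦ ?_⟩
  simpa [internalProj_apply_of_mem h hm] using (hQ hm).2

include e h hX in
theorem exists_ringKrullDim_add_one_le [IsNoetherianRing S] (j : ℤ) (hj : N j ≠ ⊥)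
    (hne : ∀ l, N l ≠ ⊥ → ∃ m ∈ N l, e X • m ≠ 0) :
    ∃ l, N l ≠ ⊥ ∧ ringKrullDim (S ⧸ Module.annihilator S (N l)) + 1 ≤
      ringKrullDim (R ⧸ Module.annihilator R M) := by
  obtain ⟨a₀, ha₀⟩ := exists_forall_gt_X_smul e h hX
  have hbot : ∀ l, j ≤ l → N l ≠ ⊥ := fun l hl ↦ by
    induction l, hl using Int.leInduction with
    | base => exact hj
    | succ l _ ih =>
      obtain ⟨m, hm, hm0⟩ := hne l ih
      exact fun h0 ↦ hm0 ((Submodule.eq_bot_iff _).mp h0 _ (hX _ _ hm))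
  have hsurj (l : ℤ) (hl : a₀ ≤ l) (a : ℕ) :
      ∀ m ∈ N (l + a), ∃ n ∈ N l, e X ^ a • n = m := by
    induction a with
    | zero => simp
    | succ a ih =>
      intro m hm
      obtain ⟨n, hn, rfl⟩ := ha₀ _ (by push_cast; omega) m hm
      obtain ⟨n', hn', rfl⟩ := ih n (by convert hn using 2; push_cast; ring)
      exact ⟨n', hn', by rw [pow_succ', mul_smul]⟩
  let f : ℕ →o Ideal S :=
    { toFun n := Module.annihilator S (N (max j a₀ + n))
      monotone' := monotone_nat_of_le_succ fun n s hs ↦ by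
        rw [Module.mem_annihilator] at hs ⊢
        intro m
        obtain ⟨m', hm', hmm'⟩ := hsurj (max j a₀ + n) (by omega) 1 m
          (by convert m.2 using 2; push_cast; ring)
        have := congrArg Subtype.val (hs ⟨m', hm'⟩)
        ext
        simp only [Submodule.coe_smul, Submodule.coe_zero] at this ⊢
        rw [← hmm', smul_comm, this, smul_zero] }
  obtain ⟨n, hn⟩ := monotone_stabilizes_iff_noetherian.mpr (inferInstance : IsNoetherian S S) f
  set l := max j a₀ + n
  refine ⟨l, hbot l (by omega), (ringKrullDim_succ_le_ringKrullDim_polynomial).trans ?_⟩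
  let φ : R →+* (S ⧸ Module.annihilator S (N l))[X] :=
    (mapRingHom (Ideal.Quotient.mk _)).comp (e.symm : R →+* S[X])
  have hφ : Function.Surjective φ :=
    (map_surjective _ Ideal.Quotient.mk_surjective).comp e.symm.surjective
  refine ringKrullDim_le_of_surjective (Ideal.Quotient.lift _ φ fun r hr ↦ ?_)
    (Ideal.Quotient.lift_surjective_of_surjective _ _ hφ)
  obtain ⟨p, rfl⟩ := e.surjective r
  have hp (a : ℕ) : p.coeff a ∈ Module.annihilator S (N l) := by
    have : Module.annihilator S (N l) = Module.annihilator S (N (l + a)) := by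
      have := hn (n + a) (by omega)
      rwa [show f (n + a) = Module.annihilator S (N (l + a)) from
        congrArg (fun i ↦ Module.annihilator S (N i)) (by push_cast; ring)] at this
    rw [this, Module.mem_annihilator]
    rintro ⟨m, hm⟩
    obtain ⟨m', hm', rfl⟩ := hsurj l (by omega) a m hm
    have := internalProj_algEquiv_smul e h hX p hm' a
    rw [Module.mem_annihilator.mp hr, map_zero] at this
    exact Subtype.ext this.symm
  ext a
  simpa [φ] using Ideal.Quotient.eq_zero_iff_mem.mpr (hp a)

end GradedPolynomialModule

instance torFunctor_additive {k S : Type} [Field k] [CommRing S] [Algebra k S]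
    (K : ModuleCat.{0} S) (i : ℕ) : (torFunctor k S K i).Additive := by
  have : ((Tor (ModuleCat S) i).obj K).Additive :=
    leftDerived_additive ((MonoidalCategory.tensoringLeft (ModuleCat S)).obj K) i
  infer_instance

section TorStep

open Polynomial

variable {k S R : Type} [Field k] [CommRing S] [CommRing R] [Algebra S R]

/-- The identity map, from a module over both rings to its restriction of scalars. -/
noncomputable def isoResScalars (M : Type) [AddCommGroup M] [Module R M] [Module S M]
    [IsScalarTower S R M] : ModuleCat.of S M ≅ (resScalars S R).obj (ModuleCat.of R M) :=
  let f : M ≃ₗ[S] ((resScalars S R).obj (ModuleCat.of R M)) :=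
    { toFun := fun m ↦ m
      invFun := fun m ↦ m
      left_inv := fun _ ↦ rfl
      right_inv := fun _ ↦ rfl
      map_add' := fun _ _ ↦ rfl
      map_smul' := fun s m ↦ (algebraMap_smul R s m).symm }
  f.toModuleIso

/-- Division by the variable, as a linear map. -/
noncomputable def divXLinear (S : Type*) [CommRing S] : S[X] →ₗ[S] S[X] where
  toFun := divX
  map_add' _ _ := divX_add
  map_smul' _ _ := by
    ext
    simp [coeff_divX]

variable {M : Type} [AddCommGroup M] [Module R M] [Module S M] [IsScalarTower S R M]
  (e : S[X] ≃ₐ[S] R) {N : ℤ → Submodule S M} (h : DirectSum.IsInternal N)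
  (hX : ∀ j, ∀ m ∈ N j, e X • m ∈ N (j + 1))

include h hX

theorem rank_obj_le_rank_coker_X [Module.Finite R M] (G : ModuleCat.{0} S ⥤ ModuleCat.{0} k)
    [G.Additive] (j : ℤ) :
    Module.rank k (G.obj (ModuleCat.of S (N j))) ≤
      Module.rank k (G.obj ((resScalars S R).obj (ModuleCat.of R M)) ⧸
        LinearMap.range (G.map ((resScalars S R).map (e X • 𝟙 (ModuleCat.of R M)))).hom) := by
  obtain ⟨a, ha⟩ := exists_forall_lt_eq_bot e h hX
  refine rank_obj_le_rank_coker_map G _ (fun j ↦ ModuleCat.of S (N j))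
    (fun j ↦ ModuleCat.ofHom (N j).subtype ≫ (isoResScalars M).hom)
    (fun j ↦ (isoResScalars M).inv ≫ ModuleCat.ofHom (internalProj h j))
    (fun j ↦ ModuleCat.ofHom ((Module.toModuleEnd S (S := R) M (e X)).restrict (hX j)))
    (fun j ↦ ?_) (fun j l hjl ↦ ?_) (fun j ↦ ?_) (a - 1) (fun j hj ↦ ?_) j
  · ext m
    simp [internalProj_apply_of_mem h m.2]
  · ext m
    simp [internalProj_apply_of_ne h hjl m.2]
  · ext m
    have := internalProj_X_smul e h hX (j + 1) ((isoResScalars M).inv m)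
    rw [add_sub_cancel_right] at this
    exact this
  · have := ha j (by omega)
    exact Submodule.subsingleton_iff_eq_bot.mpr this

omit hX in
theorem rank_obj_le_rank_ker_X (G : ModuleCat.{0} S ⥤ ModuleCat.{0} k) [G.Additive] (j : ℤ)
    (hj : ∀ m ∈ N j, e X • m = 0) :
    Module.rank k (G.obj (ModuleCat.of S (N j))) ≤
      Module.rank k (LinearMap.ker
        (G.map ((resScalars S R).map (e X • 𝟙 (ModuleCat.of R M)))).hom) := by
  refine rank_obj_le_rank_ker_map G _ (ModuleCat.ofHom (N j).subtype ≫ (isoResScalars M).hom)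
    ((isoResScalars M).inv ≫ ModuleCat.ofHom (internalProj h j)) ?_ ?_
  · ext m
    simp [internalProj_apply_of_mem h m.2]
  · ext m
    exact hj m m.2

theorem choose_le_rank_tor_of_pieces [Algebra k S] [Algebra k R] [IsScalarTower k S R]
    [Module.Finite R M] [IsNoetherianRing S] [Nontrivial M]
    (K : ModuleCat.{0} R) (hK : ∀ a : K, e X • a = 0) (n s : ℕ)
    (hs : ringKrullDim (R ⧸ Module.annihilator R M) ≤ s)
    (hN : ∀ j, N j ≠ ⊥ → ∀ s' : ℕ, ringKrullDim (S ⧸ Module.annihilator S (N j)) ≤ s' → ∀ i,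
      ((n - s').choose i : Cardinal) ≤ Module.rank k
        ((torFunctor k S ((resScalars S R).obj K) i).obj (ModuleCat.of S (N j)))) (i : ℕ) :
    ((n + 1 - s).choose i : Cardinal) ≤ Module.rank k
      ((resScalars k R).obj (((Tor (ModuleCat R) i).obj K).obj (ModuleCat.of R M))) := by
  have : Module.Free S R := Module.Free.of_equiv e.toLinearEquiv
  let ρ : R →ₗ[S] R := e.toLinearMap ∘ₗ divXLinear S ∘ₗ e.symm.toLinearMap
  have hρ (r : R) : ρ (e X * r) = r := by
    obtain ⟨p, rfl⟩ := e.surjective r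
    suffices hp : divX (X * p) = p by simp [ρ, ← map_mul, divXLinear, hp]
    ext
    simp [coeff_divX]
  have hx (r : R) : ∃ (s : S) (r' : R), r = algebraMap S R s + e X * r' := by
    obtain ⟨p, rfl⟩ := e.surjective r
    refine ⟨p.coeff 0, e p.divX, ?_⟩
    conv_lhs => rw [← divX_mul_X_add p]
    rw [map_add, map_mul, ← algebraMap_eq, AlgEquiv.commutes, add_comm, mul_comm]
  obtain ⟨j, hj⟩ : ∃ j, N j ≠ ⊥ := by
    by_contra! hbot
    have := h.submodule_iSup_eq_top
    rw [show N = fun _ ↦ ⊥ from funext hbot, iSup_const] at this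
    exact bot_ne_top this
  have hcoker (l : ℤ) (i : ℕ) := (rank_obj_le_rank_coker_X (k := k) e h hX
    (torFunctor k S ((resScalars S R).obj K) i) l).trans (rank_coker_tor_le _ ρ hρ hx K hK _ i)
  by_cases htop : ∃ t, N t ≠ ⊥ ∧ ∀ m ∈ N t, e X • m = 0
  · obtain ⟨t, ht, hXt⟩ := htop
    have hdim := (ringKrullDim_quotient_annihilator_le e h hX t).trans hs
    cases i with
    | zero => simpa using (hN t ht s hdim 0).trans (hcoker t 0)
    | succ i =>
      have h1 := (add_le_add (rank_obj_le_rank_coker_X (k := k) e h hX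
        (torFunctor k S ((resScalars S R).obj K) (i + 1)) t) (rank_obj_le_rank_ker_X (k := k) e h
          (torFunctor k S ((resScalars S R).obj K) i) t hXt)).trans
        (rank_coker_tor_add_rank_ker_tor_le _ ρ hρ hx K hK _ i)
      refine le_trans ?_ ((add_le_add (hN t ht s hdim (i + 1)) (hN t ht s hdim i)).trans h1)
      norm_cast
      rcases le_or_gt s n with hsn | hsn
      · rw [Nat.sub_add_comm hsn, Nat.choose_succ_succ, add_comm]
      · simp [Nat.sub_eq_zero_of_le hsn]
  · push Not at htop
    obtain ⟨l, hl, hdim⟩ := exists_ringKrullDim_add_one_le e h hX j hj htop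
    have : Nontrivial (N l) := (Submodule.nontrivial_iff_ne_bot).mpr hl
    have : Nontrivial (S ⧸ Module.annihilator S (N l)) :=
      Ideal.Quotient.nontrivial_iff.mpr fun htop ↦
        not_subsingleton _ (Module.annihilator_eq_top_iff.mp htop)
    obtain ⟨d, hd⟩ : ∃ d : ℕ∞, ringKrullDim (S ⧸ Module.annihilator S (N l)) = d :=
      ⟨_, (WithBot.coe_unbot _ ((WithBot.bot_lt_coe 0).trans_le
        ringKrullDim_nonneg_of_nontrivial).ne').symm⟩
    replace hdim := hdim.trans hs
    rw [hd] at hdim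
    obtain ⟨s', rfl⟩ : ∃ s', s = s' + 1 := by
      refine ⟨s - 1, ?_⟩
      rcases s with _ | s
      · norm_cast at hdim
        simp at hdim
      · rfl
    rw [Nat.add_sub_add_right]
    refine (hN l hl s' ?_ i).trans (hcoker l i)
    rw [hd]
    norm_cast at hdim ⊢
    push_cast at hdim
    exact (ENat.add_le_add_iff_right ENat.one_ne_top).mp hdim

end TorStep

section Multigraded

theorem isInternal_comap {ι k M P : Type*} [DecidableEq ι] [Ring k] [AddCommGroup M] [Module k M]
    [AddCommGroup P] [Module k P] {A : ι → Submodule k M} (hA : iSupIndep A) (g : P →ₗ[k] M)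
    (hg : Function.Injective g) (hr : LinearMap.range g = ⨆ i, A i) :
    DirectSum.IsInternal fun i ↦ (A i).comap g := by
  refine (DirectSum.isInternal_submodule_iff_iSupIndep_and_iSup_eq_top _).mpr ⟨fun i ↦ ?_, ?_⟩
  · refine Submodule.disjoint_def.mpr fun p hp hp' ↦ hg ?_
    rw [map_zero]
    refine Submodule.disjoint_def.mp (hA i) _ hp ?_
    have h := Submodule.mem_map_of_mem (f := g) hp'
    simp only [Submodule.map_iSup] at h
    exact iSup₂_mono (fun j _ ↦ Submodule.map_comap_le g (A j)) h
  · refine Submodule.map_injective_of_injective hg ?_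
    rw [Submodule.map_iSup, Submodule.map_top, hr]
    refine iSup_congr fun i ↦ ?_
    rw [Submodule.map_comap_eq, hr]
    exact inf_eq_right.mpr (le_iSup A i)

theorem isInternal_of_restrictScalars {ι k S M : Type*} [DecidableEq ι] [Ring k] [Ring S]
    [AddCommGroup M] [Module k M] [Module S M] [SMul k S] [IsScalarTower k S M]
    {N : ι → Submodule S M} (h : DirectSum.IsInternal fun i ↦ (N i).restrictScalars k) :
    DirectSum.IsInternal N := by
  refine (DirectSum.isInternal_submodule_iff_iSupIndep_and_iSup_eq_top _).mpr ⟨fun i ↦ ?_, ?_⟩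
  · refine Submodule.disjoint_def.mpr fun m hm hm' ↦
      Submodule.disjoint_def.mp (h.submodule_iSupIndep i) m hm ?_
    simpa only [← Submodule.restrictScalars_iSup, Submodule.restrictScalars_mem] using hm'
  · refine Submodule.restrictScalars_injective k S M ?_
    rw [Submodule.restrictScalars_iSup, h.submodule_iSup_eq_top, Submodule.restrictScalars_top]

/-- A subspace of a module over a polynomial ring that is stable under the variables,
as a submodule. -/
def submoduleOfXSMulMem {σ k M : Type*} [CommRing k] [AddCommGroup M] [Module k M]
    [Module (MvPolynomial σ k) M] [IsScalarTower k (MvPolynomial σ k) M] (P : Submodule k M)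
    (hP : ∀ i, ∀ m ∈ P, (MvPolynomial.X i : MvPolynomial σ k) • m ∈ P) :
    Submodule (MvPolynomial σ k) M where
  toAddSubmonoid := P.toAddSubmonoid
  smul_mem' p m hm := by
    change m ∈ P at hm
    change p • m ∈ P
    revert m
    induction p using MvPolynomial.induction_on with
    | C a =>
      intro m hm
      rw [← MvPolynomial.algebraMap_eq, algebraMap_smul]
      exact P.smul_mem a hm
    | add p q hp hq => intro m hm; rw [add_smul]; exact P.add_mem (hp m hm) (hq m hm)
    | mul_X p i hp => intro m hm; rw [mul_smul]; exact hp _ (hP i m hm)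

variable {n : ℕ} {k M : Type*} [Field k] [AddCommGroup M] [Module k M]

theorem iSup_cons_internal {ℳ : (Fin (n + 1) → ℤ) → Submodule k M} (hdec : DirectSum.IsInternal ℳ) :
    DirectSum.IsInternal fun j : ℤ ↦ ⨆ b : Fin n → ℤ, ℳ (Fin.cons j b) := by
  have hind := hdec.submodule_iSupIndep
  refine (DirectSum.isInternal_submodule_iff_iSupIndep_and_iSup_eq_top _).mpr ⟨fun j ↦ ?_, ?_⟩
  · have hdisj : Disjoint {a : Fin (n + 1) → ℤ | a 0 = j} {a | a 0 ≠ j} :=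
      Set.disjoint_left.mpr fun a ha ha' ↦ ha' ha
    refine (hind.disjoint_biSup_biSup hdisj).mono ?_ ?_
    · exact iSup_le fun b ↦ le_iSup₂_of_le (Fin.cons j b) (by simp) le_rfl
    · exact iSup₂_le fun l hl ↦ iSup_le fun b ↦ le_iSup₂_of_le (Fin.cons l b) (by simpa) le_rfl
  · refine top_le_iff.mp (hdec.submodule_iSup_eq_top.symm.trans_le (iSup_le fun a ↦ ?_))
    refine le_iSup_of_le (a 0) (le_iSup_of_le (Fin.tail a) ?_)
    rw [Fin.cons_self_tail]

theorem map_mem_iSup {ι : Type*} {A B : ι → Submodule k M} (f : M →ₗ[k] M) (g : ι → ι)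
    (hf : ∀ i, ∀ m ∈ A i, f m ∈ B (g i)) {m : M} (hm : m ∈ ⨆ i, A i) : f m ∈ ⨆ i, B i := by
  have h : ⨆ i, A i ≤ (⨆ i, B i).comap f :=
    iSup_le fun i m hm ↦ Submodule.mem_iSup_of_mem (g i) (hf i m hm)
  exact h hm

/-- Collecting the pieces of a `ℤ^(n+1)`-grading according to the first coordinate of the degree
gives a `ℤ`-grading whose pieces are `ℤ^n`-graded. -/
theorem exists_internal_of_multigraded [Module (MvPolynomial (Fin n) k) M]
    [IsScalarTower k (MvPolynomial (Fin n) k) M] {ℳ : (Fin (n + 1) → ℤ) → Submodule k M}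
    (hdec : DirectSum.IsInternal ℳ) (f : M →ₗ[k] M)
    (hf : ∀ a, ∀ m ∈ ℳ a, f m ∈ ℳ (a + Pi.single 0 1))
    (hgr : ∀ a (i : Fin n), ∀ m ∈ ℳ a,
      (MvPolynomial.X i : MvPolynomial (Fin n) k) • m ∈ ℳ (a + Pi.single i.succ 1)) :
    ∃ N : ℤ → Submodule (MvPolynomial (Fin n) k) M, DirectSum.IsInternal N ∧
      (∀ j, ∀ m ∈ N j, f m ∈ N (j + 1)) ∧
      ∀ j, ∃ 𝒩 : (Fin n → ℤ) → Submodule k (N j), DirectSum.IsInternal 𝒩 ∧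
        ∀ b i, ∀ m ∈ 𝒩 b,
          (MvPolynomial.X i : MvPolynomial (Fin n) k) • m ∈ 𝒩 (b + Pi.single i 1) := by
  have h0 (j : ℤ) (b : Fin n → ℤ) :
      (Fin.cons j b + Pi.single 0 1 : Fin (n + 1) → ℤ) = Fin.cons (j + 1) b := by
    ext l
    cases l using Fin.cases <;> simp
  have hsucc (j : ℤ) (b : Fin n → ℤ) (i : Fin n) :
      (Fin.cons j b + Pi.single i.succ 1 : Fin (n + 1) → ℤ) = Fin.cons j (b + Pi.single i 1) := by
    ext l
    cases l using Fin.cases <;> simp [Pi.single_apply]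
  have hgr' (j : ℤ) (b : Fin n → ℤ) (i : Fin n) (m : M) (hm : m ∈ ℳ (Fin.cons j b)) :
      (MvPolynomial.X i : MvPolynomial (Fin n) k) • m ∈ ℳ (Fin.cons j (b + Pi.single i 1)) :=
    hsucc j b i ▸ hgr _ i m hm
  let N (j : ℤ) : Submodule (MvPolynomial (Fin n) k) M :=
    submoduleOfXSMulMem (⨆ b : Fin n → ℤ, ℳ (Fin.cons j b)) fun i m hm ↦
      map_mem_iSup
        ((LinearMap.lsmul (MvPolynomial (Fin n) k) M (MvPolynomial.X i)).restrictScalars k)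
        (fun b ↦ b + Pi.single i 1) (fun b m hm ↦ hgr' j b i m hm) hm
  have hN : (fun j ↦ (N j).restrictScalars k) = fun j ↦ ⨆ b : Fin n → ℤ, ℳ (Fin.cons j b) :=
    funext fun j ↦ SetLike.ext fun m ↦ Iff.rfl
  have hint : DirectSum.IsInternal fun j ↦ (N j).restrictScalars k := by
    rw [hN]
    exact iSup_cons_internal hdec
  refine ⟨N, isInternal_of_restrictScalars hint, fun j m hm ↦ ?_, fun j ↦ ?_⟩
  · exact map_mem_iSup f id (fun b m hm ↦ h0 j b ▸ hf _ m hm) hm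
  · refine ⟨fun b ↦ (ℳ (Fin.cons j b)).comap ((N j).subtype.restrictScalars k), ?_, ?_⟩
    · have hind : iSupIndep fun b : Fin n → ℤ ↦ ℳ (Fin.cons j b) :=
        hdec.submodule_iSupIndep.comp (Fin.cons_right_injective (α := fun _ ↦ ℤ) j)
      have hrange : LinearMap.range ((N j).subtype.restrictScalars k) =
          ⨆ b : Fin n → ℤ, ℳ (Fin.cons j b) := by
        ext m
        exact ⟨by rintro ⟨m, rfl⟩; exact m.2, fun hm ↦ ⟨⟨m, hm⟩, rfl⟩⟩
      exact isInternal_comap hind _ (N j).subtype_injective hrange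
    · exact fun b i m hm ↦ hgr' j b i m hm

end Multigraded

section PolynomialRing

variable (k : Type) [Field k] (n : ℕ)

theorem finSuccEquiv_rename_succ (p : MvPolynomial (Fin n) k) :
    MvPolynomial.finSuccEquiv k n (MvPolynomial.rename Fin.succ p) = Polynomial.C p := by
  induction p using MvPolynomial.induction_on with
  | C a => simp [MvPolynomial.finSuccEquiv_apply]
  | add p q hp hq => simp [hp, hq]
  | mul_X p i hp => rw [map_mul, map_mul, hp, MvPolynomial.rename_X,
      MvPolynomial.finSuccEquiv_X_succ, map_mul]

/-- `k[u₁,…,u_{n+1}]` as an algebra over the polynomial ring in all but the first variable. -/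
noncomputable abbrev renameSuccAlgebra :
    Algebra (MvPolynomial (Fin n) k) (MvPolynomial (Fin (n + 1)) k) :=
  (MvPolynomial.rename Fin.succ : MvPolynomial (Fin n) k →ₐ[k] _).toRingHom.toAlgebra

theorem isField_mvPolynomial_fin_zero : IsField (MvPolynomial (Fin 0) k) :=
  (MvPolynomial.isEmptyAlgEquiv k (Fin 0)).toMulEquiv.isField (Field.toIsField k)

theorem nontrivial_tensorProduct_of_isField {R : Type*} [CommRing R] (hR : IsField R)
    (K M : Type*) [AddCommGroup K] [Module R K] [Nontrivial K] [AddCommGroup M] [Module R M]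
    [Nontrivial M] : Nontrivial (TensorProduct R K M) := by
  let := hR.toField
  infer_instance

end PolynomialRing

/-- A multigraded version of the bound on Betti numbers, for an arbitrary nonzero module `K` that is
annihilated by the variables in place of the residue field. -/
theorem choose_le_rank_tor_of_multigraded {k : Type} [Field k] (n : ℕ) :
    ∀ (M : Type) [AddCommGroup M] [Module (MvPolynomial (Fin n) k) M] [Module k M]
      [IsScalarTower k (MvPolynomial (Fin n) k) M] [Module.Finite (MvPolynomial (Fin n) k) M]
      [Nontrivial M] (ℳ : (Fin n → ℤ) → Submodule k M) (_ : DirectSum.IsInternal ℳ)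
      (_ : ∀ a i, ∀ x ∈ ℳ a,
        (MvPolynomial.X i : MvPolynomial (Fin n) k) • x ∈ ℳ (a + Pi.single i 1))
      (K : ModuleCat.{0} (MvPolynomial (Fin n) k)) [Nontrivial K]
      (_ : ∀ i, ∀ x : K, (MvPolynomial.X i : MvPolynomial (Fin n) k) • x = 0) (s : ℕ)
      (_ : ringKrullDim (MvPolynomial (Fin n) k ⧸
        Module.annihilator (MvPolynomial (Fin n) k) M) ≤ s) (i : ℕ),
      ((n - s).choose i : Cardinal) ≤ Module.rank k
        ((torFunctor k (MvPolynomial (Fin n) k) K i).obj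
          (ModuleCat.of (MvPolynomial (Fin n) k) M)) := by
  induction n with
  | zero =>
    intro M _ _ _ _ _ _ ℳ hdec hgr K _ hK s hs i
    rcases i with _ | i
    · have : Nontrivial (((MonoidalCategory.tensoringLeft
          (ModuleCat (MvPolynomial (Fin 0) k))).obj K).obj
            (ModuleCat.of (MvPolynomial (Fin 0) k) M)) :=
        nontrivial_tensorProduct_of_isField (isField_mvPolynomial_fin_zero k) K M
      let e := ((MonoidalCategory.tensoringLeft
        (ModuleCat (MvPolynomial (Fin 0) k))).obj K).leftDerivedZeroIsoSelf.app
          (ModuleCat.of (MvPolynomial (Fin 0) k) M)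
      have : Nontrivial ((resScalars k (MvPolynomial (Fin 0) k)).obj
          (((Tor (ModuleCat (MvPolynomial (Fin 0) k)) 0).obj K).obj
            (ModuleCat.of (MvPolynomial (Fin 0) k) M))) :=
        e.toLinearEquiv.toEquiv.nontrivial (α := ((Tor (ModuleCat (MvPolynomial (Fin 0) k)) 0).obj
          K).obj (ModuleCat.of (MvPolynomial (Fin 0) k) M))
      simpa using Cardinal.one_le_iff_pos.mpr (rank_pos (R := k))
    · simp
  | succ n ih =>
    intro M _ _ _ _ _ _ ℳ hdec hgr K _ hK s hs i
    let := renameSuccAlgebra k n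
    let : Module (MvPolynomial (Fin n) k) M :=
      Module.compHom M (algebraMap (MvPolynomial (Fin n) k) (MvPolynomial (Fin (n + 1)) k))
    have : IsScalarTower k (MvPolynomial (Fin n) k) (MvPolynomial (Fin (n + 1)) k) :=
      IsScalarTower.of_algebraMap_eq fun a ↦ (AlgHom.commutes (MvPolynomial.rename Fin.succ) a).symm
    have : IsScalarTower (MvPolynomial (Fin n) k) (MvPolynomial (Fin (n + 1)) k) M :=
      ⟨fun p q m ↦ by rw [Algebra.smul_def, mul_smul]; rfl⟩
    have : IsScalarTower k (MvPolynomial (Fin n) k) M :=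
      IsScalarTower.of_algebraMap_smul fun a m ↦ by
        rw [← algebraMap_smul (MvPolynomial (Fin (n + 1)) k),
          ← IsScalarTower.algebraMap_apply, algebraMap_smul]
    let e : Polynomial (MvPolynomial (Fin n) k) ≃ₐ[MvPolynomial (Fin n) k]
        MvPolynomial (Fin (n + 1)) k :=
      AlgEquiv.ofRingEquiv (f := (MvPolynomial.finSuccEquiv k n).symm.toRingEquiv) fun p ↦
        (MvPolynomial.finSuccEquiv k n).symm_apply_eq.mpr (finSuccEquiv_rename_succ k n p).symm
    have heX : e Polynomial.X = MvPolynomial.X 0 :=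
      (MvPolynomial.finSuccEquiv k n).symm_apply_eq.mpr MvPolynomial.finSuccEquiv_X_zero.symm
    have hX (l : Fin n) : algebraMap (MvPolynomial (Fin n) k) (MvPolynomial (Fin (n + 1)) k)
        (MvPolynomial.X l) = MvPolynomial.X l.succ := MvPolynomial.rename_X _ _
    obtain ⟨N, hN, hN', hpieces⟩ := exists_internal_of_multigraded hdec
      ((LinearMap.lsmul (MvPolynomial (Fin (n + 1)) k) M (MvPolynomial.X 0)).restrictScalars k)
      (fun a m hm ↦ hgr a 0 m hm) (fun a l m hm ↦ by
        rw [← algebraMap_smul (MvPolynomial (Fin (n + 1)) k), hX]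
        exact hgr a l.succ m hm)
    refine choose_le_rank_tor_of_pieces e hN (fun j m hm ↦ heX ▸ hN' j m hm) K
      (fun a ↦ heX ▸ hK 0 a) n s hs (fun j hj s' hs' i ↦ ?_) i
    obtain ⟨𝒩, h𝒩, h𝒩'⟩ := hpieces j
    have : Nontrivial (N j) := Submodule.nontrivial_iff_ne_bot.mpr hj
    have : Module.Finite (MvPolynomial (Fin n) k) (N j) :=
      finite_of_internal e hN (fun j m hm ↦ heX ▸ hN' j m hm) j
    have : Nontrivial
        ((resScalars (MvPolynomial (Fin n) k) (MvPolynomial (Fin (n + 1)) k)).obj K) :=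
      inferInstanceAs (Nontrivial K)
    refine ih (N j) 𝒩 h𝒩 h𝒩' _ (fun l x ↦ ?_) s' hs' i
    rw [← algebraMap_smul (MvPolynomial (Fin (n + 1)) k), hX]
    exact hK l.succ x

/-- **Charalambous' theorem** (generalizing Evans–Griffith). Let
`R = k[u₁,…,u_r]` be the polynomial ring over a field `k`, and let `M` be a
finitely generated `ℤ^r`-multigraded `R`-module (the multigrading being given
by an internal direct sum decomposition `M = ⊕_{a ∈ ℤ^r} ℳ_a` into
`k`-subspaces with `u_i · ℳ_a ⊆ ℳ_{a + e_i}`) of Krull dimension `s` (i.e.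
`R / Ann(M)` has Krull dimension `s`). Then
`dim_k Tor_i^R(k, M) ≥ C(r − s, i)` for every `i ≥ 0`, where `k = R/(u₁,…,u_r)`
is the residue field. -/
theorem charalambous_tor_lower_bound {r : ℕ} (k : Type) [Field k]
    (M : Type) [AddCommGroup M] [Module (MvPolynomial (Fin r) k) M]
    [Module k M] [IsScalarTower k (MvPolynomial (Fin r) k) M]
    [Module.Finite (MvPolynomial (Fin r) k) M]
    (ℳ : (Fin r → ℤ) → Submodule k M) (hdec : DirectSum.IsInternal ℳ)
    (hgr : ∀ (a : Fin r → ℤ) (i : Fin r), ∀ x ∈ ℳ a,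
      (MvPolynomial.X i : MvPolynomial (Fin r) k) • x ∈ ℳ (a + Pi.single i 1))
    (s : ℕ)
    (hs : ringKrullDim
      (MvPolynomial (Fin r) k ⧸
        Module.annihilator (MvPolynomial (Fin r) k) M) = s)
    (i : ℕ) :
    letI : Module (MvPolynomial (Fin r) k) k :=
      Module.compHom k (MvPolynomial.constantCoeff (σ := Fin r) (R := k))
    letI T := ((Tor (ModuleCat (MvPolynomial (Fin r) k)) i).obj
        (ModuleCat.of (MvPolynomial (Fin r) k) k)).obj
        (ModuleCat.of (MvPolynomial (Fin r) k) M)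
    letI : Module k T := Module.compHom T (algebraMap k (MvPolynomial (Fin r) k))
    ((r - s).choose i : Cardinal) ≤ Module.rank k T := by
  let : Module (MvPolynomial (Fin r) k) k :=
    Module.compHom k (MvPolynomial.constantCoeff (σ := Fin r) (R := k))
  have : Nontrivial M := by
    by_contra h
    rw [not_nontrivial_iff_subsingleton] at h
    rw [Module.annihilator_eq_top_iff.mpr h, ringKrullDim_eq_bot_of_subsingleton] at hs
    exact WithBot.bot_ne_coe hs
  exact choose_le_rank_tor_of_multigraded r M ℳ hdec hgr
    (ModuleCat.of (MvPolynomial (Fin r) k) k) (fun i x ↦ by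
      change MvPolynomial.constantCoeff (MvPolynomial.X i) * x = 0
      simp) s hs.le i
end
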